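/- arXiv:0801.2456 — 5 statements merged into one kernel-verified Lean document; each statement's English description precedes it below -/
import Mathlib

section
/- Let Λ be a nonempty class of probability mass functions on ℕ+, let p̂(k) = sup_{P ∈ Λ} P(k), and let the tail function be F̄(u) = Σ_{k > u} p̂(k). Then for every integer n ≥ 2 and every integer u with 1 ≤ u ≤ n, the minimax regret satisfies R*(Λ^n) ≤ n·F̄(u)·log e + ((u−1)/2)·log n + 2. -/
open scoped ENNReal BigOperators

noncomputable section

/-- `p` is a probability mass function on `α`. -/
def IsPmf {α : Type*} (p : α → ℝ) : Prop := (∀ a, 0 ≤ p a) ∧ HasSum p 1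

/-- The `n`-fold product probability mass function. -/
def prodPmf {α : Type*} (p : α → ℝ) (n : ℕ) : (Fin n → α) → ℝ :=
  fun x => ∏ i, p (x i)

/-- base-2 logarithm of the ratio `a / b`, valued in `[0,∞]`:
it is `⊤` when `b = 0 < a`, and clipped at `0` from below (which does not affect
the suprema defining minimax regret, which are always nonnegative). -/
def regretTerm (a b : ℝ) : ℝ≥0∞ :=
  if a ≤ 0 then 0 else if b ≤ 0 then ⊤ else ENNReal.ofReal (Real.logb 2 (a / b))

/-- Minimax regret (base 2) of the class `Λ` for word length `n`, valued in `[0,∞]`. -/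
def minimaxRegret {α : Type*} (Λ : Set (α → ℝ)) (n : ℕ) : ℝ≥0∞ :=
  ⨅ (Q : (Fin n → α) → ℝ) (_ : IsPmf Q),
    ⨆ (x : Fin n → α), ⨆ P ∈ Λ, regretTerm (prodPmf P n x) (Q x)

/- Kullback-Leibler divergence `D(p‖q)` in base 2, valued in `[0,∞]`.
It is `⊤` unless `q` dominates `p`; otherwise it is computed through the
pointwise-nonnegative decomposition `p log(p/q) + q - p` (summing to
`Σ p log(p/q)` since `Σ p = Σ q = 1`), converted from nats to bits. -/
open Classical in
def klDiv2 {α : Type*} (p q : α → ℝ) : ℝ≥0∞ :=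
  if ∃ a, q a = 0 ∧ 0 < p a then ⊤
  else (∑' a, ENNReal.ofReal (p a * Real.log (p a / q a) + q a - p a)) /
       ENNReal.ofReal (Real.log 2)

/-- Minimax redundancy (base 2) of the class `Λ` for word length `n`, valued in `[0,∞]`. -/
def minimaxRedundancy {α : Type*} (Λ : Set (α → ℝ)) (n : ℕ) : ℝ≥0∞ :=
  ⨅ (Q : (Fin n → α) → ℝ) (_ : IsPmf Q), ⨆ P ∈ Λ, klDiv2 (prodPmf P n) Q

/-- The envelope class defined by the envelope function `f`. -/
def envClass (f : ℕ+ → ℝ) : Set (ℕ+ → ℝ) := {P | IsPmf P ∧ ∀ k, P k ≤ f k}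

/-- The rising factorial `a (a + 1) ⋯ (a + m - 1)`. -/
def rising (a : ℝ) (m : ℕ) : ℝ := ∏ i ∈ Finset.range m, ((i : ℝ) + a)

@[simp] lemma rising_zero (a : ℝ) : rising a 0 = 1 := by simp [rising]

lemma rising_succ (a : ℝ) (m : ℕ) : rising a (m + 1) = rising a m * (m + a) :=
  Finset.prod_range_succ _ _

lemma rising_pos {a : ℝ} (ha : 0 < a) (m : ℕ) : 0 < rising a m :=
  Finset.prod_pos fun i _ => by positivity

lemma rising_add_one_mul (a : ℝ) (m : ℕ) : rising (a + 1) m * a = rising a m * (m + a) := by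
  induction m with
  | zero => simp
  | succ m ih =>
    rw [rising_succ, rising_succ, mul_right_comm, ih]
    push_cast
    ring

/-- Consecutive ratios of `c ^ c / rising (1 / 2) c` are nondecreasing. -/
lemma succ_pow_mul_le (c : ℕ) :
    ((c : ℝ) + 1) ^ (c + 1) * (c + 1) ^ (c + 1) * (c + 3 / 2) ≤
      ((c : ℝ) + 2) ^ (c + 2) * (c : ℝ) ^ c * (c + 1 / 2) := by
  rcases Nat.eq_zero_or_pos c with rfl | hc
  · norm_num
  let f : ℝ → ℝ := fun t => (t + 1) * Real.log (t + 1) - t * Real.log t - Real.log (t + 1 / 2)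
  have hd : ∀ t : ℝ, 0 < t →
      HasDerivAt f (Real.log (t + 1) - Real.log t - 1 / (t + 1 / 2)) t := by
    intro t ht
    have h1 := (hasDerivAt_id t).add_const 1
    have h2 := h1.mul (h1.log (by simp; positivity))
    have h3 := (hasDerivAt_id t).mul ((hasDerivAt_id t).log (by simp; positivity))
    have h4 := ((hasDerivAt_id t).add_const (1 / 2)).log (by simp; positivity)
    refine ((h2.sub h3).sub h4).congr_deriv ?_
    simp only [id]
    have : t ≠ 0 := ht.ne'
    have : t + 1 ≠ 0 := by positivity
    field_simp
    ring
  have hmono : MonotoneOn f (Set.Ioi 0) := by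
    apply monotoneOn_of_deriv_nonneg (convex_Ioi 0)
    · exact fun t ht => (hd t ht).continuousAt.continuousWithinAt
    · intro t ht
      rw [interior_Ioi] at ht
      exact (hd t ht).differentiableAt.differentiableWithinAt
    · intro t ht
      rw [interior_Ioi] at ht
      have ht : 0 < t := ht
      rw [(hd t ht).deriv, ← Real.log_div (by positivity) ht.ne']
      have := Real.le_log_one_add_of_nonneg (x := 1 / t) (by positivity)
      have e1 : (t + 1) / t = 1 + 1 / t := by field_simp
      have e2 : 2 * (1 / t) / (1 / t + 2) = 1 / (t + 1 / 2) := by field_simp; ring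
      rw [e1]
      linarith
  have hc' : (0 : ℝ) < c := by exact_mod_cast hc
  have h := hmono (show (c : ℝ) ∈ Set.Ioi 0 from hc')
    (show (c : ℝ) + 1 ∈ Set.Ioi 0 from by simp; positivity) (by linarith)
  simp only [f] at h
  rw [← Real.log_le_log_iff (by positivity) (by positivity),
    Real.log_mul (by positivity) (by positivity), Real.log_mul (by positivity) (by positivity),
    Real.log_mul (by positivity) (by positivity), Real.log_mul (by positivity) (by positivity)]
  simp only [Real.log_pow]
  push_cast
  rw [show (c : ℝ) + 1 + 1 = c + 2 by ring, show (c : ℝ) + 1 + 1 / 2 = c + 3 / 2 by ring] at h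
  linarith

/-- The ratio between the maximum likelihood and the Krichevsky–Trofimov weight of `c` equal
symbols. -/
def ktRatio (c : ℕ) : ℝ := (c : ℝ) ^ c / rising (1 / 2) c

@[simp] lemma ktRatio_zero : ktRatio 0 = 1 := by simp [ktRatio]

lemma pow_self_pos (c : ℕ) : (0 : ℝ) < (c : ℝ) ^ c := by
  rcases Nat.eq_zero_or_pos c with rfl | hc
  · simp
  · positivity

lemma ktRatio_pos (c : ℕ) : 0 < ktRatio c :=
  div_pos (pow_self_pos c) (rising_pos (by norm_num) c)

lemma monotone_ktRatio_succ_div : Monotone fun c => ktRatio (c + 1) / ktRatio c := by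
  have e : ∀ c : ℕ, ktRatio (c + 1) / ktRatio c =
      ((c : ℝ) + 1) ^ (c + 1) / ((c : ℝ) ^ c * (c + 1 / 2)) := by
    intro c
    have h1 := (pow_self_pos c).ne'
    have h2 := (rising_pos (a := 1 / 2) (by norm_num) c).ne'
    have h3 : (c : ℝ) + 1 / 2 ≠ 0 := by positivity
    simp only [ktRatio, rising_succ]
    push_cast
    field_simp
  refine monotone_nat_of_le_succ fun c => ?_
  have h1 := pow_self_pos c
  rw [e, e, div_le_div_iff₀ (by positivity) (by positivity)]
  have := succ_pow_mul_le c
  push_cast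
  rw [show (c : ℝ) + 1 + 1 = c + 2 by ring]
  linarith

lemma ktRatio_mul_le (a b : ℕ) : ktRatio a * ktRatio b ≤ ktRatio (a + b) := by
  induction b with
  | zero => simp
  | succ b ih =>
    have h := monotone_ktRatio_succ_div (show b ≤ a + b by omega)
    have hb := ktRatio_pos b
    have hab := ktRatio_pos (a + b)
    have ha := ktRatio_pos a
    simp only at h
    calc ktRatio a * ktRatio (b + 1)
        = ktRatio a * ktRatio b * (ktRatio (b + 1) / ktRatio b) := by field_simp
      _ ≤ ktRatio (a + b) * (ktRatio (a + b + 1) / ktRatio (a + b)) :=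
          mul_le_mul ih h (div_pos (ktRatio_pos _) hb).le hab.le
      _ = ktRatio (a + (b + 1)) := by rw [← add_assoc]; field_simp

lemma prod_ktRatio_le {α : Type*} (J : Finset α) (c : α → ℕ) :
    ∏ j ∈ J, ktRatio (c j) ≤ ktRatio (∑ j ∈ J, c j) := by
  classical
  induction J using Finset.induction_on with
  | empty => simp
  | insert a s ha ih =>
    rw [Finset.prod_insert ha, Finset.sum_insert ha]
    exact (mul_le_mul_of_nonneg_left ih (ktRatio_pos _).le).trans (ktRatio_mul_le _ _)

/-- The empirical distribution maximizes the likelihood. -/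
lemma prod_pow_mul_pow_le {α : Type*} (J : Finset α) (c : α → ℕ) (p : α → ℝ)
    (hp : ∀ j, 0 ≤ p j) (hp1 : ∑ j ∈ J, p j ≤ 1) :
    (∏ j ∈ J, p j ^ c j) * ((∑ j ∈ J, c j : ℕ) : ℝ) ^ (∑ j ∈ J, c j) ≤
      ∏ j ∈ J, (c j : ℝ) ^ c j := by
  set m := ∑ j ∈ J, c j with hm
  have key : ∀ j ∈ J, (p j * m) ^ c j ≤ (c j : ℝ) ^ c j * Real.exp (p j * m - c j) := by
    intro j _
    have hpm : 0 ≤ p j * m := mul_nonneg (hp j) m.cast_nonneg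
    rcases Nat.eq_zero_or_pos (c j) with h | h
    · simpa [h] using hpm
    · have hc : (0 : ℝ) < c j := by exact_mod_cast h
      have h1 : p j * m ≤ c j * Real.exp (p j * m / c j - 1) := by
        have := Real.add_one_le_exp (p j * m / c j - 1)
        rw [sub_add_cancel, div_le_iff₀ hc] at this
        linarith
      calc (p j * m) ^ c j ≤ (c j * Real.exp (p j * m / c j - 1)) ^ c j :=
            pow_le_pow_left₀ hpm h1 _
        _ = _ := by
            rw [mul_pow, ← Real.exp_nat_mul]
            congr 2
            field_simp
  calc (∏ j ∈ J, p j ^ c j) * (m : ℝ) ^ m = ∏ j ∈ J, (p j * m) ^ c j := by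
        simp_rw [mul_pow]
        rw [Finset.prod_mul_distrib, Finset.prod_pow_eq_pow_sum]
    _ ≤ ∏ j ∈ J, ((c j : ℝ) ^ c j * Real.exp (p j * m - c j)) :=
        Finset.prod_le_prod (fun j _ => pow_nonneg (mul_nonneg (hp j) m.cast_nonneg) _) key
    _ = (∏ j ∈ J, (c j : ℝ) ^ c j) * Real.exp ((∑ j ∈ J, p j) * m - m) := by
        rw [Finset.prod_mul_distrib, ← Real.exp_sum, Finset.sum_sub_distrib, ← Finset.sum_mul]
        simp [hm]
    _ ≤ (∏ j ∈ J, (c j : ℝ) ^ c j) * 1 := by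
        gcongr
        rw [Real.exp_le_one_iff]
        nlinarith [m.cast_nonneg (α := ℝ)]
    _ = _ := mul_one _

/-- The likelihood of the counts is bounded by the Krichevsky–Trofimov weights. -/
lemma prod_pow_mul_rising_le {α : Type*} (J : Finset α) (c : α → ℕ) (p : α → ℝ)
    (hp : ∀ j, 0 ≤ p j) (hp1 : ∑ j ∈ J, p j ≤ 1) :
    (∏ j ∈ J, p j ^ c j) * rising (1 / 2) (∑ j ∈ J, c j) ≤
      ∏ j ∈ J, rising (1 / 2) (c j) := by
  have h1 := prod_pow_mul_pow_le J c p hp hp1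
  have h2 := prod_ktRatio_le J c
  simp only [ktRatio] at h2
  rw [Finset.prod_div_distrib] at h2
  set m := ∑ j ∈ J, c j
  have hD : 0 < rising (1 / 2) m := rising_pos (by norm_num) m
  have hE : 0 < ∏ j ∈ J, rising (1 / 2) (c j) :=
    Finset.prod_pos fun j _ => rising_pos (by norm_num) _
  rw [div_le_div_iff₀ hE hD] at h2
  have hm := pow_self_pos m
  refine le_of_mul_le_mul_right ?_ hm
  calc _ = (∏ j ∈ J, p j ^ c j) * (m : ℝ) ^ m * rising (1 / 2) m := by ring
    _ ≤ (∏ j ∈ J, (c j : ℝ) ^ c j) * rising (1 / 2) m := by gcongr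
    _ ≤ _ := by linarith

/-- The worst-case likelihood ratio of the Krichevsky–Trofimov mixture over `u` symbols. -/
def ktBound (u n : ℕ) : ℝ := rising (u / 2) n / rising (1 / 2) n

lemma ktBound_succ (u n : ℕ) :
    ktBound u (n + 1) = ktBound u n * ((n + u / 2) / (n + 1 / 2)) := by
  simp only [ktBound, rising_succ]
  rw [mul_div_mul_comm]

lemma ktBound_pos {u : ℕ} (hu : 1 ≤ u) (n : ℕ) : 0 < ktBound u n := by
  have : (0 : ℝ) < u := by exact_mod_cast hu
  exact div_pos (rising_pos (by positivity) n) (rising_pos (by norm_num) n)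

lemma monotone_ktBound {u : ℕ} (hu : 1 ≤ u) : Monotone (ktBound u) := by
  refine monotone_nat_of_le_succ fun n => ?_
  rw [ktBound_succ]
  have : (1 : ℝ) ≤ u := by exact_mod_cast hu
  refine le_mul_of_one_le_right (ktBound_pos hu n).le ?_
  rw [one_le_div (by positivity)]
  linarith

lemma ktBound_add_two {u : ℕ} (hu : 1 ≤ u) (n : ℕ) :
    ktBound (u + 2) n = ktBound u n * (2 * n / u + 1) := by
  have hu' : (0 : ℝ) < u := by exact_mod_cast hu
  have h := rising_add_one_mul (u / 2 : ℝ) n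
  have hD := (rising_pos (a := 1 / 2) (by norm_num) n).ne'
  simp only [ktBound]
  push_cast
  rw [show ((u : ℝ) + 2) / 2 = u / 2 + 1 by ring]
  have h2 : rising ((u : ℝ) / 2 + 1) n = rising (u / 2) n * (n + u / 2) / (u / 2) := by
    rw [← h]
    field_simp
  rw [h2]
  field_simp

lemma ktBound_one (n : ℕ) : ktBound 1 n = 1 := by
  simp only [ktBound, Nat.cast_one]
  exact div_self (rising_pos (by norm_num) n).ne'

lemma ktBound_two_sq_le {n : ℕ} (hn : 1 ≤ n) : ktBound 2 n ^ 2 ≤ 4 * n := by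
  induction n, hn using Nat.le_induction with
  | base => norm_num [ktBound, rising]
  | succ n hn ih =>
    rw [ktBound_succ, mul_pow]
    have hn' : (1 : ℝ) ≤ n := by exact_mod_cast hn
    calc _ ≤ 4 * (n : ℝ) * (((n : ℝ) + (2 : ℕ) / 2) / (n + 1 / 2)) ^ 2 := by gcongr
      _ ≤ _ := by
        push_cast
        rw [div_pow, ← mul_div_assoc, div_le_iff₀ (by positivity)]
        nlinarith

lemma ktBound_sq_le {u n : ℕ} (hn : 2 ≤ n) (hu : 1 ≤ u) (hun : u ≤ n) :
    ktBound u n ^ 2 ≤ 16 * (n : ℝ) ^ (u - 1) := by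
  have hn' : (2 : ℝ) ≤ n := by exact_mod_cast hn
  induction u using Nat.strong_induction_on with
  | _ u ih =>
    match u, hu with
    | 1, _ => norm_num [ktBound_one]
    | 2, _ =>
      have := ktBound_two_sq_le (n := n) (by omega)
      simp only [Nat.add_one_sub_one, pow_one]
      linarith
    | 3, _ =>
      rw [show 3 = 1 + 2 from rfl, ktBound_add_two le_rfl, ktBound_one]
      norm_num
      nlinarith
    | 4, _ =>
      rw [show 4 = 2 + 2 from rfl, ktBound_add_two (by norm_num), mul_pow]
      have := ktBound_two_sq_le (n := n) (by omega)
      calc _ ≤ 4 * (n : ℝ) * (2 * n / (2 : ℕ) + 1) ^ 2 := by gcongr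
        _ ≤ 4 * (n : ℝ) * (2 * n) ^ 2 := by
          gcongr
          push_cast
          linarith
        _ = _ := by norm_num; ring
    | u + 5, _ =>
      have h := ih (u + 3) (by omega) (by omega) (by omega)
      rw [show u + 5 = u + 3 + 2 from rfl, ktBound_add_two (by omega), mul_pow]
      have hun' : ((u + 5 : ℕ) : ℝ) ≤ n := by exact_mod_cast hun
      push_cast at hun'
      have hu0 : (0 : ℝ) ≤ u := u.cast_nonneg
      calc _ ≤ 16 * (n : ℝ) ^ (u + 3 - 1) * (n : ℝ) ^ 2 := by
            gcongr
            push_cast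
            rw [← le_sub_iff_add_le, div_le_iff₀ (by positivity)]
            nlinarith
        _ = _ := by
            rw [mul_assoc, ← pow_add]
            congr 2

section Mixture

variable {α : Type*} [DecidableEq α]

/-- The number of occurrences of the symbol `j` in the word `x`. -/
def symbolCount {n : ℕ} (x : Fin n → α) (j : α) : ℕ := ∑ i, if x i = j then 1 else 0

lemma symbolCount_cons {n : ℕ} (a : α) (x : Fin n → α) (j : α) :
    symbolCount (Fin.cons a x : Fin (n + 1) → α) j =
      symbolCount x j + if a = j then 1 else 0 := by
  simp only [symbolCount, Fin.sum_univ_succ, Fin.cons_zero, Fin.cons_succ]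
  exact add_comm _ _

lemma sum_symbolCount_le {n : ℕ} (x : Fin n → α) (J : Finset α) :
    ∑ j ∈ J, symbolCount x j ≤ n := by
  simp only [symbolCount]
  rw [Finset.sum_comm]
  calc _ ≤ ∑ _i : Fin n, 1 := Finset.sum_le_sum fun i _ => by
        rw [Finset.sum_ite_eq]
        split_ifs <;> simp
    _ = n := by simp

/-- The coding distribution that uses the Krichevsky–Trofimov mixture on the symbols in `J` and
escapes to the weights `w` on the remaining symbols. -/
def censoredMixture (J : Finset α) (w : α → ℝ) (F : ℝ) (n : ℕ) (x : Fin n → α) : ℝ :=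
  (∏ i, if x i ∈ J then 1 else w (x i)) * (∏ j ∈ J, rising (1 / 2) (symbolCount x j)) /
    rising (J.card / 2) (∑ j ∈ J, symbolCount x j) / (1 + F) ^ n

/-- The predictive distribution of `censoredMixture`. -/
def censoredPredictor (J : Finset α) (w : α → ℝ) (F : ℝ) {n : ℕ} (x : Fin n → α) (a : α) : ℝ :=
  (if a ∈ J then (symbolCount x a + 1 / 2) / ((∑ j ∈ J, symbolCount x j : ℕ) + (J.card : ℝ) / 2)
    else w a) / (1 + F)

lemma censoredMixture_cons (J : Finset α) (w : α → ℝ) (F : ℝ) (n : ℕ) (a : α) (x : Fin n → α) :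
    censoredMixture J w F (n + 1) (Fin.cons a x) =
      censoredMixture J w F n x * censoredPredictor J w F x a := by
  simp only [censoredMixture, censoredPredictor, Fin.prod_univ_succ, Fin.cons_zero, Fin.cons_succ,
    symbolCount_cons, Finset.sum_add_distrib, Finset.sum_ite_eq]
  by_cases ha : a ∈ J
  · have h : ∏ j ∈ J, rising (1 / 2) (symbolCount x j + if a = j then 1 else 0) =
        (∏ j ∈ J, rising (1 / 2) (symbolCount x j)) * (symbolCount x a + 1 / 2) := by
      rw [← Finset.mul_prod_erase J _ ha, ← Finset.mul_prod_erase J _ ha]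
      have : ∏ j ∈ J.erase a, rising (1 / 2) (symbolCount x j + if a = j then 1 else 0) =
          ∏ j ∈ J.erase a, rising (1 / 2) (symbolCount x j) :=
        Finset.prod_congr rfl fun j hj => by
          simp [(Finset.ne_of_mem_erase hj).symm]
      rw [this, if_pos rfl, rising_succ]
      ring
    rw [h]
    simp only [ha, if_true, rising_succ, pow_succ, div_eq_mul_inv, mul_inv]
    ring
  · have h : ∏ j ∈ J, rising (1 / 2) (symbolCount x j + if a = j then 1 else 0) =
        ∏ j ∈ J, rising (1 / 2) (symbolCount x j) :=
      Finset.prod_congr rfl fun j hj => by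
        rw [if_neg (by rintro rfl; exact ha hj), add_zero]
    rw [h]
    simp only [ha, if_false, add_zero, pow_succ, div_eq_mul_inv, mul_inv]
    ring

lemma isPmf_censoredPredictor {J : Finset α} (hJ : J.Nonempty) {w : α → ℝ} {F : ℝ}
    (hw : ∀ a, 0 ≤ w a) (hwJ : ∀ a ∈ J, w a = 0) (hF : HasSum w F) {n : ℕ} (x : Fin n → α) :
    IsPmf (censoredPredictor J w F x) := by
  have hF0 : 0 ≤ F := hF.nonneg hw
  refine ⟨fun a => ?_, ?_⟩
  · have := hw a
    unfold censoredPredictor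
    split_ifs <;> positivity
  · have hJc : (0 : ℝ) < J.card := by exact_mod_cast hJ.card_pos
    set m := ∑ j ∈ J, symbolCount x j with hm
    let g : α → ℝ := fun a =>
      if a ∈ J then (symbolCount x a + 1 / 2) / ((m : ℝ) + (J.card : ℝ) / 2) else 0
    have hg : HasSum g 1 := by
      have h : HasSum g (∑ a ∈ J, g a) := hasSum_sum_of_ne_finset_zero fun a ha => by simp [g, ha]
      convert h using 1
      rw [Finset.sum_congr rfl fun a ha => if_pos ha, ← Finset.sum_div, Finset.sum_add_distrib,
        Finset.sum_const, ← Nat.cast_sum, ← hm, nsmul_eq_mul, mul_one_div]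
      exact (div_self (by positivity)).symm
    have h := (hg.add hF).div_const (1 + F)
    rw [div_self (by positivity)] at h
    have hfun : censoredPredictor J w F x = fun a => (g a + w a) / (1 + F) := by
      ext a
      unfold censoredPredictor
      by_cases ha : a ∈ J
      · simp [g, ha, hwJ a ha, hm]
      · simp [g, ha]
    rwa [hfun]

lemma isPmf_censoredMixture {J : Finset α} (hJ : J.Nonempty) {w : α → ℝ} {F : ℝ}
    (hw : ∀ a, 0 ≤ w a) (hwJ : ∀ a ∈ J, w a = 0) (hF : HasSum w F) (n : ℕ) :
    IsPmf (censoredMixture J w F n) := by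
  induction n with
  | zero =>
    have h : censoredMixture J w F 0 = fun _ => 1 := by
      ext x
      simp [censoredMixture, symbolCount]
    rw [h]
    exact ⟨fun _ => zero_le_one, by simp⟩
  | succ n ih =>
    have hc := fun x : Fin n → α => isPmf_censoredPredictor hJ hw hwJ hF x
    refine ⟨fun x => ?_, ?_⟩
    · rw [← Fin.cons_self_tail x, censoredMixture_cons]
      exact mul_nonneg (ih.1 _) ((hc _).1 _)
    · let e : (Fin n → α) × α ≃ (Fin (n + 1) → α) :=
        (Equiv.prodComm _ _).trans (Fin.consEquiv fun _ => α)
      rw [← e.hasSum_iff]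
      have he : censoredMixture J w F (n + 1) ∘ e =
          fun q => censoredMixture J w F n q.1 * censoredPredictor J w F q.1 q.2 := by
        ext q
        exact censoredMixture_cons J w F n q.2 q.1
      rw [he]
      have hf : ∀ x, HasSum (fun a => censoredMixture J w F n x * censoredPredictor J w F x a)
          (censoredMixture J w F n x) := fun x => by
        simpa using (hc x).2.mul_left (censoredMixture J w F n x)
      have hs : Summable fun q : (Fin n → α) × α =>
          censoredMixture J w F n q.1 * censoredPredictor J w F q.1 q.2 := by
        rw [summable_prod_of_nonneg fun q => mul_nonneg (ih.1 _) ((hc _).1 _)]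
        refine ⟨fun x => (hf x).summable, ?_⟩
        simp only [(hf _).tsum_eq]
        exact ih.2.summable
      have h := hs.hasSum.prod_fiberwise hf
      rw [← h.unique ih.2]
      exact hs.hasSum

lemma prod_eq_prod_pow_symbolCount {n : ℕ} (x : Fin n → α) (J : Finset α) (P : α → ℝ) :
    ∏ i, P (x i) = (∏ i, if x i ∈ J then 1 else P (x i)) * ∏ j ∈ J, P j ^ symbolCount x j := by
  simp only [symbolCount, ← Finset.prod_pow_eq_pow_sum]
  rw [Finset.prod_comm, ← Finset.prod_mul_distrib]
  refine Finset.prod_congr rfl fun i _ => ?_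
  have h : ∏ j ∈ J, P j ^ (if x i = j then 1 else 0) = if x i ∈ J then P (x i) else 1 := by
    rw [← Finset.prod_ite_eq J (x i) P]
    exact Finset.prod_congr rfl fun j _ => by split_ifs <;> simp
  rw [h]
  split_ifs <;> simp

lemma prodPmf_le_mul_censoredMixture {J : Finset α} (hJ : J.Nonempty) {w : α → ℝ} {F : ℝ}
    (hF : 0 ≤ F) {P : α → ℝ} (hP : IsPmf P) (hPw : ∀ a ∉ J, P a ≤ w a) (n : ℕ)
    (x : Fin n → α) :
    prodPmf P n x ≤ (1 + F) ^ n * ktBound J.card n * censoredMixture J w F n x := by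
  have hJc : (0 : ℝ) < J.card := by exact_mod_cast hJ.card_pos
  set m := ∑ j ∈ J, symbolCount x j with hm
  have hD : 0 < rising (1 / 2) m := rising_pos (by norm_num) m
  have hU : 0 < rising (J.card / 2 : ℝ) m := rising_pos (by positivity) m
  have hE : 0 < ∏ j ∈ J, rising (1 / 2) (symbolCount x j) :=
    Finset.prod_pos fun j _ => rising_pos (by norm_num) _
  have h1 : (∏ i, if x i ∈ J then 1 else P (x i)) ≤ ∏ i, if x i ∈ J then 1 else w (x i) := by
    refine Finset.prod_le_prod (fun i _ => ?_) fun i _ => ?_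
    · split_ifs
      exacts [zero_le_one, hP.1 _]
    · split_ifs with h
      exacts [le_rfl, hPw _ h]
  have h0 : 0 ≤ ∏ i, if x i ∈ J then 1 else P (x i) := Finset.prod_nonneg fun i _ => by
    split_ifs
    exacts [zero_le_one, hP.1 _]
  have h2 := prod_pow_mul_rising_le J (symbolCount x) P hP.1
    (sum_le_hasSum J (fun a _ => hP.1 a) hP.2)
  rw [← hm, ← le_div_iff₀ hD] at h2
  have hle := monotone_ktBound hJ.card_pos (sum_symbolCount_le x J)
  rw [← hm] at hle
  unfold prodPmf
  rw [prod_eq_prod_pow_symbolCount x J P]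
  calc _ ≤ (∏ i, if x i ∈ J then 1 else w (x i)) *
          ((∏ j ∈ J, rising (1 / 2) (symbolCount x j)) / rising (1 / 2) m) :=
        mul_le_mul h1 h2 (Finset.prod_nonneg fun j _ => pow_nonneg (hP.1 j) _) (h0.trans h1)
    _ = (1 + F) ^ n * ktBound J.card m * censoredMixture J w F n x := by
        have : 1 + F ≠ 0 := by positivity
        simp only [censoredMixture, ktBound, ← hm]
        field_simp
    _ ≤ _ := by
        gcongr
        exact div_nonneg (div_nonneg (mul_nonneg (h0.trans h1) hE.le) hU.le) (by positivity)

end Mixture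

lemma regretTerm_le_of_le_mul {a b C B : ℝ} (hC : 0 < C) (h : a ≤ C * b)
    (hB : Real.logb 2 C ≤ B) : regretTerm a b ≤ ENNReal.ofReal B := by
  unfold regretTerm
  split_ifs with ha hb
  · exact zero_le
  · nlinarith
  · push Not at ha hb
    refine ENNReal.ofReal_le_ofReal (le_trans ?_ hB)
    exact Real.logb_le_logb_of_le (by norm_num) (div_pos ha hb) (by rwa [div_le_iff₀ hb])

lemma logb_one_add_pow_mul_ktBound_le {u n : ℕ} (hn : 2 ≤ n) (hu : 1 ≤ u) (hun : u ≤ n) {F : ℝ}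
    (hF : 0 ≤ F) :
    Real.logb 2 ((1 + F) ^ n * ktBound u n) ≤
      n * F * Real.logb 2 (Real.exp 1) + ((u : ℝ) - 1) / 2 * Real.logb 2 n + 2 := by
  have hK := ktBound_pos hu n
  have hn' : (0 : ℝ) < n := by positivity
  have hlog2 : 0 < Real.log 2 := Real.log_pos (by norm_num)
  rw [Real.logb_mul (by positivity) hK.ne', Real.logb_pow]
  have h1 : Real.logb 2 (1 + F) ≤ F * Real.logb 2 (Real.exp 1) := by
    rw [Real.logb, Real.logb, Real.log_exp, mul_one_div]
    gcongr
    linarith [Real.log_le_sub_one_of_pos (show 0 < 1 + F by positivity)]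
  have h2 := Real.logb_le_logb_of_le (b := 2) (by norm_num) (by positivity)
    (ktBound_sq_le hn hu hun)
  rw [Real.logb_mul (by norm_num) (by positivity), Real.logb_pow, Real.logb_pow,
    show (16 : ℝ) = 2 ^ 4 by norm_num, Real.logb_pow, Real.logb_self_eq_one (by norm_num),
    Nat.cast_sub hu] at h2
  push_cast at h2
  have h3 := mul_le_mul_of_nonneg_left h1 hn'.le
  linarith

/-- the censoring upper bound on minimax regret via the tail function. -/
theorem stmt8 (Lam : Set (ℕ+ → ℝ)) (hLam : Lam.Nonempty) (hpmf : ∀ P ∈ Lam, IsPmf P)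
    (n u : ℕ) (hn : 2 ≤ n) (hu1 : 1 ≤ u) (hun : u ≤ n)
    (Fbar : ℝ≥0∞)
    (hFbar : Fbar = ∑' k : ℕ+,
      if u < (k : ℕ) then ⨆ P ∈ Lam, ENNReal.ofReal (P k) else 0) :
    minimaxRegret Lam n ≤
      (n : ℝ≥0∞) * Fbar * ENNReal.ofReal (Real.logb 2 (Real.exp 1)) +
        ENNReal.ofReal (((u : ℝ) - 1) / 2 * Real.logb 2 (n : ℝ)) + 2 := by
  by_cases htop : Fbar = ⊤
  · have he : 0 < Real.logb 2 (Real.exp 1) :=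
      Real.logb_pos (by norm_num) (Real.one_lt_exp_iff.2 one_pos)
    have hn0 : (n : ℝ≥0∞) ≠ 0 := by simp; omega
    rw [htop, ENNReal.mul_top hn0, ENNReal.top_mul (by simpa using he)]
    simp
  let w' : ℕ+ → ℝ≥0∞ := fun k => if u < (k : ℕ) then ⨆ P ∈ Lam, ENNReal.ofReal (P k) else 0
  have hsum : ∑' k, w' k ≠ ⊤ := hFbar ▸ htop
  let w : ℕ+ → ℝ := fun k => (w' k).toReal
  have hF : HasSum w Fbar.toReal := by
    rw [hFbar, ENNReal.tsum_toReal_eq (ENNReal.ne_top_of_tsum_ne_top hsum)]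
    exact (ENNReal.summable_toReal hsum).hasSum
  let J : Finset ℕ+ := Finset.Icc 1 ⟨u, hu1⟩
  have hJc : J.card = u := by
    refine (PNat.card_Icc _ _).trans ?_
    exact Nat.add_sub_cancel u 1
  have hJ : J.Nonempty := Finset.card_pos.1 (by omega)
  have hmem : ∀ k : ℕ+, k ∈ J ↔ (k : ℕ) ≤ u := fun k => by
    refine Finset.mem_Icc.trans ?_
    exact ⟨fun h => h.2, fun h => ⟨one_le, h⟩⟩
  have hw : ∀ k, 0 ≤ w k := fun k => ENNReal.toReal_nonneg
  have hwJ : ∀ k ∈ J, w k = 0 := fun k hk => by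
    simp [w, w', not_lt.2 ((hmem k).1 hk)]
  have hPw : ∀ P ∈ Lam, ∀ k ∉ J, P k ≤ w k := by
    intro P hP k hk
    rw [hmem, not_le] at hk
    rw [← ENNReal.ofReal_le_iff_le_toReal (ENNReal.ne_top_of_tsum_ne_top hsum k)]
    simp only [w', if_pos hk]
    exact le_iSup₂ (f := fun (P : ℕ+ → ℝ) (_ : P ∈ Lam) => ENNReal.ofReal (P k)) P hP
  have hF0 : 0 ≤ Fbar.toReal := ENNReal.toReal_nonneg
  have hB := logb_one_add_pow_mul_ktBound_le hn hu1 hun hF0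
  have hu' : (1 : ℝ) ≤ u := by exact_mod_cast hu1
  have hn1 : (1 : ℝ) ≤ n := by exact_mod_cast (by omega : 1 ≤ n)
  have he0 : 0 ≤ Real.logb 2 (Real.exp 1) :=
    Real.logb_nonneg (by norm_num) (Real.one_le_exp zero_le_one)
  have hl0 : 0 ≤ ((u : ℝ) - 1) / 2 * Real.logb 2 n :=
    mul_nonneg (by linarith) (Real.logb_nonneg (by norm_num) hn1)
  have hrhs : (n : ℝ≥0∞) * Fbar * ENNReal.ofReal (Real.logb 2 (Real.exp 1)) +
      ENNReal.ofReal (((u : ℝ) - 1) / 2 * Real.logb 2 (n : ℝ)) + 2 =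
      ENNReal.ofReal (n * Fbar.toReal * Real.logb 2 (Real.exp 1) +
        ((u : ℝ) - 1) / 2 * Real.logb 2 n + 2) := by
    rw [ENNReal.ofReal_add (by positivity) (by norm_num), ENNReal.ofReal_add (by positivity) hl0,
      ENNReal.ofReal_mul (p := n * Fbar.toReal) (by positivity),
      ENNReal.ofReal_mul (p := n) (by positivity), ENNReal.ofReal_natCast, ENNReal.ofReal_toReal htop, ENNReal.ofReal_ofNat]
  rw [hrhs]
  refine iInf₂_le_of_le (censoredMixture J w Fbar.toReal n)
    (isPmf_censoredMixture hJ hw hwJ hF n) (iSup_le fun x => iSup₂_le fun P hP => ?_)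
  refine regretTerm_le_of_le_mul (mul_pos (by positivity) (ktBound_pos hu1 n)) ?_ hB
  have h := prodPmf_le_mul_censoredMixture hJ hF0 (hpmf P hP) (hPw P hP) n x
  rwa [hJc] at h
end
end

section
/- Let Λ be a nonempty class of probability mass functions on ℕ+. Then R*(Λ^1) < ∞ if and only if both R*(Λ^n)/n → 0 and R+(Λ^n)/n → 0 as n → ∞ (in particular, whenever the minimax regret is finite, both the minimax regret and the minimax redundancy are o(n)). -/
open scoped ENNReal BigOperators

noncomputable section

theorem regretTerm_le_ofReal_iff {a b r : ℝ} (hb : 0 ≤ b) (hr : 0 ≤ r) :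
    regretTerm a b ≤ ENNReal.ofReal r ↔ a ≤ 2 ^ r * b := by
  unfold regretTerm
  split_ifs with ha hb'
  · simp only [zero_le, true_iff]
    exact ha.trans (by positivity)
  · have : b = 0 := le_antisymm hb' hb
    subst this
    simpa using ha
  · push Not at ha hb'
    rw [ENNReal.ofReal_le_ofReal_iff hr, Real.logb_le_iff_le_rpow one_lt_two (by positivity),
      div_le_iff₀ hb']

theorem IsPmf.finSucc {α : Type*} {n : ℕ} {p : α → ℝ} {q : (Fin n → α) → ℝ}
    (hp : IsPmf p) (hq : IsPmf q) :
    IsPmf fun x : Fin (n + 1) → α => p (x 0) * q (Fin.tail x) := by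
  refine ⟨fun x => mul_nonneg (hp.1 _) (hq.1 _), ?_⟩
  have hs : Summable fun z : α × (Fin n → α) => p z.1 * q z.2 :=
    hp.2.summable.mul_of_nonneg hq.2.summable hp.1 hq.1
  have h := hp.2.mul hq.2 hs
  rw [one_mul] at h
  rw [← (Fin.consEquiv fun _ : Fin (n + 1) => α).hasSum_iff]
  simpa [Function.comp_def, Fin.consEquiv] using h

theorem IsPmf.prodPmf {α : Type*} {p : α → ℝ} (hp : IsPmf p) (n : ℕ) :
    IsPmf (prodPmf p n) := by
  induction n with
  | zero =>
    refine ⟨fun x => by simp [_root_.prodPmf], ?_⟩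
    have := hasSum_fintype (_root_.prodPmf p 0)
    simpa [_root_.prodPmf] using this
  | succ n ih =>
    have := IsPmf.finSucc hp ih
    convert this using 2 with x
    simp [_root_.prodPmf, Fin.prod_univ_succ, Fin.tail]

theorem klDiv2_le_of_regretTerm_le {α : Type*} {p q : α → ℝ} (hp : IsPmf p) (hq : IsPmf q)
    {r : ℝ≥0∞} (h : ∀ a, regretTerm (p a) (q a) ≤ r) : klDiv2 p q ≤ r := by
  rcases eq_or_ne r ⊤ with rfl | hr
  · exact le_top
  obtain ⟨t, ht, rfl⟩ : ∃ t : ℝ, 0 ≤ t ∧ r = ENNReal.ofReal t :=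
    ⟨r.toReal, ENNReal.toReal_nonneg, (ENNReal.ofReal_toReal hr).symm⟩
  have hle : ∀ a, p a ≤ 2 ^ t * q a := fun a =>
    (regretTerm_le_ofReal_iff (hq.1 a) ht).1 (h a)
  have hlog2 : 0 < Real.log 2 := Real.log_pos one_lt_two
  unfold klDiv2
  rw [if_neg]
  swap
  · rintro ⟨a, ha, hpa⟩
    have := hle a
    rw [ha, mul_zero] at this
    exact this.not_gt hpa
  have hpos : ∀ a, 0 < p a → 0 < q a := fun a ha =>
    pos_of_mul_pos_right (ha.trans_le (hle a)) (by positivity)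
  set f : α → ℝ := fun a => p a * Real.log (p a / q a) + q a - p a
  set g : α → ℝ := fun a => p a * (t * Real.log 2) + q a - p a
  have hf : ∀ a, 0 ≤ f a := by
    intro a
    rcases (hp.1 a).eq_or_lt with h0 | h0
    · simpa [f, ← h0] using hq.1 a
    · have hqa := hpos a h0
      have h1 := Real.one_sub_inv_le_log_of_pos (div_pos h0 hqa)
      have h2 := mul_le_mul_of_nonneg_left h1 h0.le
      have h3 : p a * (1 - (p a / q a)⁻¹) = p a - q a := by field_simp
      simp only [f]
      linarith
  have hfg : ∀ a, f a ≤ g a := by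
    intro a
    rcases (hp.1 a).eq_or_lt with h0 | h0
    · simp [f, g, ← h0]
    · have hqa := hpos a h0
      have h1 : Real.log (p a / q a) ≤ t * Real.log 2 := by
        rw [← Real.log_rpow two_pos]
        exact Real.log_le_log (by positivity) ((div_le_iff₀ hqa).2 (hle a))
      have h2 := mul_le_mul_of_nonneg_left h1 h0.le
      simp only [f, g]
      linarith
  have hg : HasSum g (t * Real.log 2) := by
    simpa using ((hp.2.mul_right (t * Real.log 2)).add hq.2).sub hp.2
  refine ENNReal.div_le_of_le_mul ?_
  calc ∑' a, ENNReal.ofReal (f a) ≤ ∑' a, ENNReal.ofReal (g a) :=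
        ENNReal.tsum_le_tsum fun a => ENNReal.ofReal_le_ofReal (hfg a)
    _ = ENNReal.ofReal (t * Real.log 2) := by
        rw [← ENNReal.ofReal_tsum_of_nonneg (fun a => (hf a).trans (hfg a)) hg.summable,
          hg.tsum_eq]
    _ = _ := ENNReal.ofReal_mul ht

theorem minimaxRedundancy_le_minimaxRegret {α : Type*} {Λ : Set (α → ℝ)}
    (hΛ : ∀ P ∈ Λ, IsPmf P) (n : ℕ) : minimaxRedundancy Λ n ≤ minimaxRegret Λ n := by
  refine iInf₂_mono fun Q hQ => iSup₂_le fun P hP => ?_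
  refine klDiv2_le_of_regretTerm_le ((hΛ P hP).prodPmf n) hQ fun x => ?_
  exact le_iSup_of_le x (le_iSup₂_of_le P hP le_rfl)

theorem minimaxRegret_le_ofReal {α : Type*} {Λ : Set (α → ℝ)} {n : ℕ} {r : ℝ} (hr : 0 ≤ r)
    {Q : (Fin n → α) → ℝ} (hQ : IsPmf Q)
    (h : ∀ P ∈ Λ, ∀ x, prodPmf P n x ≤ 2 ^ r * Q x) :
    minimaxRegret Λ n ≤ ENNReal.ofReal r :=
  iInf₂_le_of_le Q hQ <| iSup_le fun x => iSup₂_le fun P hP =>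
    (regretTerm_le_ofReal_iff (hQ.1 x) hr).2 (h P hP x)

theorem exists_isPmf_of_minimaxRegret_lt_top {α : Type*} {Λ : Set (α → ℝ)} {n : ℕ}
    (h : minimaxRegret Λ n < ⊤) : ∃ r : ℝ, 0 ≤ r ∧ ∃ Q : (Fin n → α) → ℝ, IsPmf Q ∧
      ∀ P ∈ Λ, ∀ x, prodPmf P n x ≤ 2 ^ r * Q x := by
  simp only [minimaxRegret, iInf_lt_iff] at h
  obtain ⟨Q, hQ, h⟩ := h
  refine ⟨(⨆ x, ⨆ P ∈ Λ, regretTerm (prodPmf P n x) (Q x)).toReal, ENNReal.toReal_nonneg, Q, hQ,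
    fun P hP x => ?_⟩
  refine (regretTerm_le_ofReal_iff (hQ.1 x) ENNReal.toReal_nonneg).1 ?_
  rw [ENNReal.ofReal_toReal h.ne]
  exact le_iSup_of_le x (le_iSup₂_of_le P hP le_rfl)

theorem minimaxRegret_one_lt_top_of_le {α : Type*} {Λ : Set (α → ℝ)} {r : ℝ} (hr : 0 ≤ r)
    {q : α → ℝ} (hq : IsPmf q) (h : ∀ P ∈ Λ, ∀ a, P a ≤ 2 ^ r * q a) :
    minimaxRegret Λ 1 < ⊤ :=
  (minimaxRegret_le_ofReal hr (hq.prodPmf 1) fun P hP x => by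
    simpa [prodPmf] using h P hP (x 0)).trans_lt ENNReal.ofReal_lt_top

theorem minimaxRegret_one_lt_top_of_succ {α : Type*} {Λ : Set (α → ℝ)}
    (hΛ : ∀ P ∈ Λ, IsPmf P) {n : ℕ} (h : minimaxRegret Λ (n + 1) < ⊤) :
    minimaxRegret Λ 1 < ⊤ := by
  obtain ⟨r, hr, Q, hQ, hle⟩ := exists_isPmf_of_minimaxRegret_lt_top h
  have hs : HasSum (fun z : α × (Fin n → α) => Q (Fin.cons z.1 z.2)) 1 :=
    (Fin.consEquiv fun _ : Fin (n + 1) => α).hasSum_iff.2 hQ.2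
  have hfib : ∀ a, Summable fun y : Fin n → α => Q (Fin.cons a y) := fun a =>
    hs.summable.prod_factor a
  refine minimaxRegret_one_lt_top_of_le (q := fun a => ∑' y : Fin n → α, Q (Fin.cons a y)) hr
    ⟨fun a => tsum_nonneg fun y => hQ.1 _, hs.prod_fiberwise fun a => (hfib a).hasSum⟩
    fun P hP a => ?_
  have h1 := ((hΛ P hP).prodPmf n).2.mul_left (P a)
  rw [mul_one] at h1
  refine hasSum_le (fun y => ?_) h1 ((hfib a).hasSum.mul_left _)
  simpa [prodPmf, Fin.prod_univ_succ] using hle P hP (Fin.cons a y)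

theorem exists_finset_summable_tsum_le {α : Type*} [DecidableEq α] {M : α → ℝ}
    (hM : Summable M) {ε : ℝ} (hε : 0 < ε) :
    ∃ s : Finset α, ∃ N : ℕ, 0 < N ∧
      Summable (fun a => if a ∈ s then (1 : ℝ) / N else M a) ∧
      ∑' a, (if a ∈ s then (1 : ℝ) / N else M a) ≤ ε := by
  obtain ⟨s, hs⟩ := ((tendsto_order.1 hM.hasSum).1 (∑' a, M a - ε / 2) (by linarith)).exists
  obtain ⟨N, hN⟩ := exists_nat_gt (s.card / (ε / 2))
  have hN0 : (0 : ℝ) < N := lt_of_le_of_lt (by positivity) hN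
  have h1 : HasSum (fun a => if a ∈ s then (1 : ℝ) / N - M a else 0)
      (∑ a ∈ s, ((1 : ℝ) / N - M a)) := by
    rw [Finset.sum_congr rfl fun a ha => (if_pos ha).symm]
    exact hasSum_sum_of_ne_finset_zero fun a ha => if_neg ha
  have h2 : HasSum (fun a => if a ∈ s then (1 : ℝ) / N else M a)
      (∑ a ∈ s, ((1 : ℝ) / N - M a) + ∑' a, M a) := by
    convert h1.add hM.hasSum using 2 with a
    split_ifs <;> ring
  refine ⟨s, N, by exact_mod_cast hN0, h2.summable, ?_⟩
  rw [h2.tsum_eq, Finset.sum_sub_distrib, Finset.sum_const, nsmul_eq_mul]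
  have h3 : (s.card : ℝ) * (1 / N) ≤ ε / 2 := by
    rw [mul_one_div, div_le_iff₀ hN0]
    rw [div_lt_iff₀ (by positivity)] at hN
    linarith
  linarith

/-- A class dominated by a summable function has, for every `ε > 0`, a finite family of
probability mass functions dominating it up to the factor `1 + ε`. -/
theorem exists_finite_isPmf_cover {α : Type*} {Λ : Set (α → ℝ)} (hΛ : ∀ P ∈ Λ, IsPmf P)
    {M : α → ℝ} (hM : Summable M) (hle : ∀ P ∈ Λ, ∀ a, P a ≤ M a) {ε : ℝ} (hε : 0 < ε) :
    ∃ G : Set (α → ℝ), G.Finite ∧ (∀ q ∈ G, IsPmf q) ∧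
      ∀ P ∈ Λ, ∃ q ∈ G, ∀ a, P a ≤ (1 + ε) * q a := by
  classical
  obtain ⟨s, N, hN, hh, hhε⟩ := exists_finset_summable_tsum_le hM hε
  have hN' : (0 : ℝ) < N := by exact_mod_cast hN
  set h : α → ℝ := fun a => if a ∈ s then (1 : ℝ) / N else M a
  let F : (s → ℕ) → α → ℝ := fun v a => if ha : a ∈ s then (v ⟨a, ha⟩ : ℝ) / N else M a
  let c : (α → ℝ) → s → ℕ := fun P a => ⌈N * P a⌉₊
  let norm : (α → ℝ) → α → ℝ := fun g a => (∑' b, g b)⁻¹ * g a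
  have hlow : ∀ P ∈ Λ, ∀ a, P a ≤ F (c P) a := by
    intro P hP a
    by_cases ha : a ∈ s
    · simp only [F, c, ha, dif_pos]
      rw [le_div_iff₀ hN', mul_comm]
      exact Nat.le_ceil _
    · simpa [F, ha] using hle P hP a
  have hupp : ∀ P ∈ Λ, ∀ a, F (c P) a ≤ P a + h a := by
    intro P hP a
    have h0 := (hΛ P hP).1 a
    by_cases ha : a ∈ s
    · simp only [F, c, h, ha, dif_pos, if_pos]
      rw [div_le_iff₀ hN', add_mul, one_div, inv_mul_cancel₀ hN'.ne', mul_comm (P a)]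
      exact (Nat.ceil_lt_add_one (by positivity)).le
    · simpa [F, h, ha] using h0
  have hsum : ∀ P ∈ Λ, Summable (F (c P)) := fun P hP =>
    Summable.of_nonneg_of_le (fun a => ((hΛ P hP).1 a).trans (hlow P hP a)) (hupp P hP)
      ((hΛ P hP).2.summable.add hh)
  have hone : ∀ P ∈ Λ, 1 ≤ ∑' a, F (c P) a := fun P hP =>
    hasSum_le (hlow P hP) (hΛ P hP).2 (hsum P hP).hasSum
  have htot : ∀ P ∈ Λ, ∑' a, F (c P) a ≤ 1 + ε := fun P hP =>
    (hasSum_le (hupp P hP) (hsum P hP).hasSum ((hΛ P hP).2.add hh.hasSum)).trans (by linarith)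
  refine ⟨(fun P => norm (F (c P))) '' Λ, ?_, ?_, fun P hP => ⟨_, ⟨P, hP, rfl⟩, fun a => ?_⟩⟩
  · refine ((Set.finite_Iic fun _ : s => N).image fun v => norm (F v)).subset ?_
    rintro _ ⟨P, hP, rfl⟩
    refine ⟨c P, fun a => Nat.ceil_le.2 ?_, rfl⟩
    have : P a ≤ 1 := le_hasSum (hΛ P hP).2 a fun b _ => (hΛ P hP).1 b
    exact mul_le_of_le_one_right hN'.le this
  · rintro _ ⟨P, hP, rfl⟩
    have h1 := hone P hP
    refine ⟨fun a => mul_nonneg (by positivity) (((hΛ P hP).1 a).trans (hlow P hP a)), ?_⟩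
    have := (hsum P hP).hasSum.mul_left (∑' b, F (c P) b)⁻¹
    rwa [inv_mul_cancel₀ (by positivity)] at this
  · have h1 := hone P hP
    have h2 := ((hΛ P hP).1 a).trans (hlow P hP a)
    refine (hlow P hP a).trans ?_
    simp only [norm]
    rw [← mul_assoc, ← div_eq_mul_inv]
    exact le_mul_of_one_le_left h2 ((one_le_div (by positivity)).2 (htot P hP))

theorem IsPmf.average {α : Type*} {G : Finset (α → ℝ)} (hG : G.Nonempty)
    (h : ∀ q ∈ G, IsPmf q) (n : ℕ) :
    IsPmf fun x => (G.card : ℝ)⁻¹ * ∑ q ∈ G, _root_.prodPmf q n x := by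
  have hc : (G.card : ℝ) ≠ 0 := by simpa using hG.ne_empty
  refine ⟨fun x => mul_nonneg (by positivity)
    (Finset.sum_nonneg fun q hq => ((h q hq).prodPmf n).1 x), ?_⟩
  have := (hasSum_sum fun q hq => ((h q hq).prodPmf n).2).mul_left (G.card : ℝ)⁻¹
  simpa [hc] using this

theorem exists_minimaxRegret_le {α : Type*} {Λ : Set (α → ℝ)} (hne : Λ.Nonempty)
    (hΛ : ∀ P ∈ Λ, IsPmf P) (h : minimaxRegret Λ 1 < ⊤) {δ : ℝ} (hδ : 0 < δ) :
    ∃ A : ℝ, 0 ≤ A ∧ ∀ n : ℕ, minimaxRegret Λ n ≤ ENNReal.ofReal (A + n * δ) := by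
  obtain ⟨r, hr, Q, hQ, hle⟩ := exists_isPmf_of_minimaxRegret_lt_top h
  have hε : 0 < (2 : ℝ) ^ δ - 1 := sub_pos.2 (Real.one_lt_rpow one_lt_two hδ)
  have hQs : Summable fun a : α => 2 ^ r * Q fun _ => a :=
    ((Equiv.funUnique (Fin 1) α).symm.summable_iff.2 hQ.2.summable).mul_left _
  obtain ⟨G, hGf, hG, hcov⟩ := exists_finite_isPmf_cover hΛ hQs
    (fun P hP a => by simpa [prodPmf] using hle P hP fun _ => a) hε
  lift G to Finset (α → ℝ) using hGf
  simp only [Finset.mem_coe, add_sub_cancel] at hG hcov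
  obtain ⟨P₀, hP₀⟩ := hne
  obtain ⟨q₀, hq₀, -⟩ := hcov P₀ hP₀
  have hGne : G.Nonempty := ⟨q₀, hq₀⟩
  have hc : (1 : ℝ) ≤ G.card := by exact_mod_cast hGne.card_pos
  have hA : 0 ≤ Real.logb 2 G.card := Real.logb_nonneg one_lt_two hc
  refine ⟨Real.logb 2 G.card, hA, fun n => ?_⟩
  refine minimaxRegret_le_ofReal (by positivity) (IsPmf.average hGne hG n) fun P hP x => ?_
  obtain ⟨q, hq, hPq⟩ := hcov P hP
  have h1 : prodPmf P n x ≤ (2 ^ δ) ^ n * prodPmf q n x := by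
    calc ∏ i, P (x i) ≤ ∏ i, 2 ^ δ * q (x i) :=
          Finset.prod_le_prod (fun i _ => (hΛ P hP).1 _) fun i _ => hPq _
      _ = _ := by simp [Finset.prod_mul_distrib, prodPmf]
  have h2 : prodPmf q n x ≤ ∑ q ∈ G, prodPmf q n x :=
    Finset.single_le_sum (f := fun q => prodPmf q n x)
      (fun q hq => ((hG q hq).prodPmf n).1 x) hq
  rw [Real.rpow_add two_pos, Real.rpow_logb two_pos (by norm_num) (by positivity),
    mul_comm (n : ℝ), Real.rpow_mul_natCast two_pos.le]
  calc prodPmf P n x ≤ (2 ^ δ) ^ n * ∑ q ∈ G, prodPmf q n x :=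
        h1.trans (mul_le_mul_of_nonneg_left h2 (by positivity))
    _ = _ := by field_simp

theorem tendsto_minimaxRegret_div {α : Type*} {Λ : Set (α → ℝ)} (hne : Λ.Nonempty)
    (hΛ : ∀ P ∈ Λ, IsPmf P) (h : minimaxRegret Λ 1 < ⊤) :
    Filter.Tendsto (fun n : ℕ => minimaxRegret Λ n / (n : ℝ≥0∞)) Filter.atTop (nhds 0) := by
  rw [ENNReal.tendsto_nhds_zero]
  intro ε hε
  obtain ⟨δ, hδ0, hδε⟩ := ENNReal.lt_iff_exists_nnreal_btwn.1 hε
  have hδ : (0 : ℝ) < δ := by exact_mod_cast hδ0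
  obtain ⟨A, hA, hle⟩ := exists_minimaxRegret_le hne hΛ h (half_pos hδ)
  obtain ⟨N, hN⟩ := exists_nat_gt (A / (δ / 2))
  filter_upwards [Filter.eventually_ge_atTop N] with n hn
  have hAn : A ≤ n * (δ / 2) := by
    rw [div_lt_iff₀ (half_pos hδ)] at hN
    exact hN.le.trans (by gcongr)
  refine (ENNReal.div_le_of_le_mul ?_).trans hδε.le
  refine (hle n).trans ((ENNReal.ofReal_le_ofReal (?_ : _ ≤ (δ : ℝ) * n)).trans_eq ?_)
  · linarith
  · rw [ENNReal.ofReal_mul hδ.le, ENNReal.ofReal_coe_nnreal, ENNReal.ofReal_natCast]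

/-- finiteness of the minimax regret is equivalent to both the regret
and the redundancy being `o(n)`. -/
theorem stmt9 (Lam : Set (ℕ+ → ℝ)) (hLam : Lam.Nonempty) (hpmf : ∀ P ∈ Lam, IsPmf P) :
    minimaxRegret Lam 1 < ⊤ ↔
      (Filter.Tendsto (fun n : ℕ => minimaxRegret Lam n / (n : ℝ≥0∞)) Filter.atTop
          (nhds 0) ∧
        Filter.Tendsto (fun n : ℕ => minimaxRedundancy Lam n / (n : ℝ≥0∞)) Filter.atTop
          (nhds 0)) := by
  refine ⟨fun h => ?_, fun h => ?_⟩
  · have hreg := tendsto_minimaxRegret_div hLam hpmf h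
    exact ⟨hreg, tendsto_of_tendsto_of_tendsto_of_le_of_le tendsto_const_nhds hreg
      (fun _ => zero_le) fun n =>
        ENNReal.div_le_div_right (minimaxRedundancy_le_minimaxRegret hpmf n) _⟩
  · obtain ⟨n, hn, hn0⟩ := ((h.1.eventually (gt_mem_nhds ENNReal.zero_lt_top)).and
      (Filter.eventually_gt_atTop 0)).exists
    obtain ⟨m, rfl⟩ := Nat.exists_eq_add_one.2 hn0
    refine minimaxRegret_one_lt_top_of_succ hpmf (n := m) (lt_top_iff_ne_top.2 fun htop => ?_)
    rw [htop, ENNReal.top_div_of_ne_top (ENNReal.natCast_ne_top _)] at hn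
    exact lt_irrefl _ hn
end
end

section
/- Let f : ℕ+ → [0,1] be non-increasing and summable, and set c(p) = Σ_{k=1}^p f(2k) and c(∞) = Σ_{k≥1} f(2k). Assume c(∞) > 1. Let p ∈ ℕ+ satisfy c(p) > 1 and f(2p) > 0, and let n ∈ ℕ+, ε > 0 and λ ∈ (0,1) satisfy n > (c(p)/f(2p))·(10/(ε(1−λ))). Then R+(Λ_f^n) ≥ C(p,n,λ,ε)·Σ_{i=1}^p ( (1/2)·log( n(1−λ)π f(2i) / (2 c(p) e) ) − ε ), where C(p,n,λ,ε) = [1/(1 + c(p)/(λ² n f(2p)))]·(1 − (4/π)·√(5 c(p)/((1−λ) ε n f(2p)))). -/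
open scoped ENNReal BigOperators

noncomputable section

/-- The positive natural number `k + 1`. -/
def pnat (k : ℕ) : ℕ+ := ⟨k + 1, Nat.succ_pos k⟩

section ArcsinePrior
open Real MeasureTheory intervalIntegral Filter Topology

/-- The moments `∫ sin^(2k) cos^(2l)` over a quarter period. -/
def trigMoment (k l : ℕ) : ℝ := ∫ x in (0 : ℝ)..(π / 2), sin x ^ (2 * k) * cos x ^ (2 * l)

/-- The moments of `log ∘ sin` with respect to `sin^(2k) cos^(2l)` over a quarter period. -/
def logTrigMoment (k l : ℕ) : ℝ :=
  ∫ x in (0 : ℝ)..(π / 2), sin x ^ (2 * k) * cos x ^ (2 * l) * log (sin x)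

lemma intervalIntegrable_trig (k l : ℕ) (a b : ℝ) :
    IntervalIntegrable (fun x => sin x ^ (2 * k) * cos x ^ (2 * l)) volume a b :=
  Continuous.intervalIntegrable (by fun_prop) _ _

lemma intervalIntegrable_trig_mul_log_sin (k l : ℕ) (a b : ℝ) :
    IntervalIntegrable (fun x => sin x ^ (2 * k) * cos x ^ (2 * l) * log (sin x)) volume a b :=
  (intervalIntegrable_log_sin (a := a) (b := b)).continuousOn_mul
    (Continuous.continuousOn (by fun_prop))

lemma trigMoment_zero_zero : trigMoment 0 0 = π / 2 := by simp [trigMoment]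

lemma logTrigMoment_zero_zero : logTrigMoment 0 0 = -log 2 * π / 2 := by
  simp [logTrigMoment, integral_log_sin_zero_pi_div_two]

lemma trigMoment_comm (k l : ℕ) : trigMoment k l = trigMoment l k := by
  unfold trigMoment
  have h := intervalIntegral.integral_comp_sub_left
    (fun x => sin x ^ (2 * k) * cos x ^ (2 * l)) (π / 2) (a := 0) (b := π / 2)
  simp only [sub_self, sub_zero] at h
  rw [← h]
  refine intervalIntegral.integral_congr fun x _ => ?_
  simp only [sin_pi_div_two_sub, cos_pi_div_two_sub]
  ring

lemma integral_trig_mul_log_cos (k l : ℕ) :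
    ∫ x in (0 : ℝ)..(π / 2), sin x ^ (2 * k) * cos x ^ (2 * l) * log (cos x) =
      logTrigMoment l k := by
  unfold logTrigMoment
  have h := intervalIntegral.integral_comp_sub_left
    (fun x => sin x ^ (2 * l) * cos x ^ (2 * k) * log (sin x)) (π / 2) (a := 0) (b := π / 2)
  simp only [sub_self, sub_zero] at h
  rw [← h]
  refine intervalIntegral.integral_congr fun x _ => ?_
  simp only [sin_pi_div_two_sub, cos_pi_div_two_sub]
  ring

lemma trigMoment_add (k l : ℕ) :
    trigMoment (k + 1) l + trigMoment k (l + 1) = trigMoment k l := by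
  unfold trigMoment
  rw [← intervalIntegral.integral_add (intervalIntegrable_trig _ _ _ _)
    (intervalIntegrable_trig _ _ _ _)]
  refine intervalIntegral.integral_congr fun x _ => ?_
  have := sin_sq_add_cos_sq x
  linear_combination sin x ^ (2 * k) * cos x ^ (2 * l) * this

lemma logTrigMoment_add (k l : ℕ) :
    logTrigMoment (k + 1) l + logTrigMoment k (l + 1) = logTrigMoment k l := by
  unfold logTrigMoment
  rw [← intervalIntegral.integral_add (intervalIntegrable_trig_mul_log_sin _ _ _ _)
    (intervalIntegrable_trig_mul_log_sin _ _ _ _)]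
  refine intervalIntegral.integral_congr fun x _ => ?_
  have := sin_sq_add_cos_sq x
  linear_combination sin x ^ (2 * k) * cos x ^ (2 * l) * log (sin x) * this

lemma trigMoment_parts (k l : ℕ) :
    (2 * k + 1) * trigMoment k (l + 1) = (2 * l + 1) * trigMoment (k + 1) l := by
  have h : ∫ x in (0 : ℝ)..(π / 2), ((2 * k + 1) * (sin x ^ (2 * k) * cos x ^ (2 * (l + 1)))
      - (2 * l + 1) * (sin x ^ (2 * (k + 1)) * cos x ^ (2 * l))) =
      sin (π / 2) ^ (2 * k + 1) * cos (π / 2) ^ (2 * l + 1)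
        - sin 0 ^ (2 * k + 1) * cos 0 ^ (2 * l + 1) := by
    refine intervalIntegral.integral_eq_sub_of_hasDerivAt
      (f := fun x => sin x ^ (2 * k + 1) * cos x ^ (2 * l + 1)) (fun x _ => ?_)
      (Continuous.intervalIntegrable (by fun_prop) _ _)
    refine (((hasDerivAt_sin x).pow (2 * k + 1)).mul
      ((hasDerivAt_cos x).pow (2 * l + 1))).congr_deriv ?_
    simp only [Nat.add_sub_cancel, Pi.pow_apply]
    push_cast
    ring
  rw [intervalIntegral.integral_sub ((intervalIntegrable_trig _ _ _ _).const_mul _)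
    ((intervalIntegrable_trig _ _ _ _).const_mul _), intervalIntegral.integral_const_mul,
    intervalIntegral.integral_const_mul] at h
  simp only [sin_zero, cos_pi_div_two] at h
  simp only [trigMoment]
  simp at h
  linarith

lemma logTrigMoment_parts (k l : ℕ) :
    (2 * k + 1) * logTrigMoment k (l + 1) + trigMoment k (l + 1) =
      (2 * l + 1) * logTrigMoment (k + 1) l := by
  have hcont : Continuous fun x : ℝ =>
      sin x ^ (2 * k) * cos x ^ (2 * l + 1) * (sin x * log (sin x)) :=
    (by fun_prop : Continuous fun x : ℝ => sin x ^ (2 * k) * cos x ^ (2 * l + 1)).mul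
      (continuous_mul_log.comp continuous_sin)
  have hInt := (((intervalIntegrable_trig_mul_log_sin k (l + 1) 0 (π / 2)).const_mul
    (2 * k + 1 : ℝ)).add (intervalIntegrable_trig k (l + 1) 0 (π / 2))).sub
    ((intervalIntegrable_trig_mul_log_sin (k + 1) l 0 (π / 2)).const_mul (2 * l + 1 : ℝ))
  have h := intervalIntegral.integral_eq_sub_of_hasDerivAt_of_le (by positivity : (0 : ℝ) ≤ π / 2)
    hcont.continuousOn (fun x hx => ?deriv) hInt
  case deriv =>
    have hs : sin x ≠ 0 :=
      (sin_pos_of_pos_of_lt_pi hx.1 (by have := hx.2; have := pi_pos; linarith)).ne'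
    refine ((((hasDerivAt_sin x).pow (2 * k)).mul ((hasDerivAt_cos x).pow (2 * l + 1))).mul
      ((hasDerivAt_sin x).mul ((hasDerivAt_sin x).log hs))).congr_deriv ?_
    simp only [Nat.add_sub_cancel, Pi.pow_apply, Pi.mul_apply]
    push_cast
    rcases k with _ | k
    · field_simp
      simp
      ring
    · simp only [Nat.cast_add, Nat.cast_one, show 2 * (k + 1) - 1 = 2 * k + 1 by omega]
      field_simp
      ring
  · rw [intervalIntegral.integral_sub, intervalIntegral.integral_add,
      intervalIntegral.integral_const_mul, intervalIntegral.integral_const_mul] at h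
    · simp only [logTrigMoment, trigMoment]
      simp at h
      linarith
    · exact (intervalIntegrable_trig_mul_log_sin _ _ _ _).const_mul _
    · exact intervalIntegrable_trig _ _ _ _
    · exact ((intervalIntegrable_trig_mul_log_sin _ _ _ _).const_mul _).add
        (intervalIntegrable_trig _ _ _ _)
    · exact (intervalIntegrable_trig_mul_log_sin _ _ _ _).const_mul _

lemma trigMoment_succ_left (k l : ℕ) :
    2 * (k + l + 1 : ℝ) * trigMoment (k + 1) l = (2 * k + 1) * trigMoment k l := by
  linear_combination trigMoment_parts k l * (-1) + (2 * k + 1) * trigMoment_add k l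

lemma trigMoment_succ_right (k l : ℕ) :
    2 * (k + l + 1 : ℝ) * trigMoment k (l + 1) = (2 * l + 1) * trigMoment k l := by
  linear_combination trigMoment_parts k l + (2 * l + 1) * trigMoment_add k l

lemma logTrigMoment_succ_left (k l : ℕ) :
    2 * (k + l + 1 : ℝ) * logTrigMoment (k + 1) l =
      (2 * k + 1) * logTrigMoment k l + trigMoment k (l + 1) := by
  linear_combination logTrigMoment_parts k l * (-1) + (2 * k + 1) * logTrigMoment_add k l

lemma logTrigMoment_succ_right (k l : ℕ) :
    2 * (k + l + 1 : ℝ) * logTrigMoment k (l + 1) =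
      (2 * l + 1) * logTrigMoment k l - trigMoment k (l + 1) := by
  linear_combination logTrigMoment_parts k l + (2 * l + 1) * logTrigMoment_add k l

lemma trigMoment_eq (k l : ℕ) :
    2 / π * trigMoment k l =
      ((2 * k).factorial / (4 ^ k * k.factorial)) * ((2 * l).factorial / (4 ^ l * l.factorial)) /
        (k + l).factorial := by
  induction k with
  | zero =>
    induction l with
    | zero => rw [trigMoment_zero_zero]; field_simp; simp
    | succ l ih =>
      have h := trigMoment_succ_right 0 l
      have h1 : trigMoment 0 (l + 1) = (2 * l + 1) / (2 * (l + 1)) * trigMoment 0 l := by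
        push_cast at h; field_simp; linarith
      rw [h1, show 2 / π * ((2 * l + 1 : ℝ) / (2 * (l + 1)) * trigMoment 0 l) =
        (2 * l + 1) / (2 * (l + 1)) * (2 / π * trigMoment 0 l) by ring, ih,
        show 2 * (l + 1) = 2 * l + 1 + 1 by ring, show 0 + (l + 1) = 0 + l + 1 by ring]
      simp only [Nat.factorial_succ]
      push_cast
      field_simp
      ring
  | succ k ih =>
    have h := trigMoment_succ_left k l
    have h1 : trigMoment (k + 1) l = (2 * k + 1) / (2 * (k + l + 1)) * trigMoment k l := by
      field_simp; linarith
    rw [h1, show 2 / π * ((2 * k + 1 : ℝ) / (2 * (k + l + 1)) * trigMoment k l) =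
      (2 * k + 1) / (2 * (k + l + 1)) * (2 / π * trigMoment k l) by ring, ih,
      show 2 * (k + 1) = 2 * k + 1 + 1 by ring, show k + 1 + l = k + l + 1 by ring]
    simp only [Nat.factorial_succ]
    push_cast
    field_simp
    ring

lemma trigMoment_pos (k l : ℕ) : 0 < trigMoment k l := by
  have h : 0 < 2 / π * trigMoment k l := by rw [trigMoment_eq]; positivity
  exact pos_of_mul_pos_right h (by positivity)

lemma logTrigMoment_eq (k l : ℕ) :
    logTrigMoment k l = trigMoment k l *
      (-log 2 + ∑ j ∈ Finset.range k, 1 / (2 * j + 1 : ℝ) - harmonic (k + l) / 2) := by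
  induction k with
  | zero =>
    induction l with
    | zero => rw [trigMoment_zero_zero, logTrigMoment_zero_zero]; simp; ring
    | succ l ih =>
      have h := trigMoment_succ_right 0 l
      have h2 := logTrigMoment_succ_right 0 l
      rw [ih] at h2
      rw [show 0 + (l + 1) = 0 + l + 1 by ring, harmonic_succ]
      push_cast at *
      refine mul_left_cancel₀ (by positivity : 2 * ((0 : ℝ) + l + 1) ≠ 0) ?_
      rw [h2]
      have h3 : trigMoment 0 l = 2 * (l + 1 : ℝ) * trigMoment 0 (l + 1) / (2 * l + 1) := by
        field_simp; linarith
      rw [h3]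
      simp only [Finset.sum_range_zero]
      field_simp
      ring
  | succ k ih =>
      have h := trigMoment_succ_left k l
      have h2 := logTrigMoment_succ_left k l
      rw [ih, show trigMoment k (l + 1) = trigMoment k l - trigMoment (k + 1) l by
        linarith [trigMoment_add k l]] at h2
      rw [show k + 1 + l = k + l + 1 by ring, harmonic_succ, Finset.sum_range_succ]
      refine mul_left_cancel₀ (by positivity : 2 * ((k : ℝ) + l + 1) ≠ 0) ?_
      rw [h2]
      have h3 : trigMoment k l = 2 * (k + l + 1 : ℝ) * trigMoment (k + 1) l / (2 * k + 1) := by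
        field_simp; linarith
      rw [h3]
      push_cast
      field_simp
      ring

lemma sum_odd_inv_eq (k : ℕ) :
    ∑ j ∈ Finset.range k, 1 / (2 * j + 1 : ℝ) = harmonic (2 * k) - harmonic k / 2 := by
  induction k with
  | zero => simp
  | succ k ih =>
    rw [Finset.sum_range_succ, ih, show 2 * (k + 1) = 2 * k + 1 + 1 by ring, harmonic_succ,
      harmonic_succ, harmonic_succ]
    push_cast
    field_simp
    ring

lemma two_div_le_log_sub_log {k : ℕ} (hk : 0 < k) :
    2 / (2 * k + 1 : ℝ) ≤ log (k + 1) - log k := by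
  have hk' : (0 : ℝ) < k := by exact_mod_cast hk
  have h := (hasSum_log_one_add_inv hk').summable.sum_le_tsum {0} fun j _ => by positivity
  rw [(hasSum_log_one_add_inv hk').tsum_eq] at h
  rw [← log_div (by positivity) hk'.ne', show ((k : ℝ) + 1) / k = 1 + (k : ℝ)⁻¹ by field_simp]
  refine le_trans (le_of_eq ?_) h
  simp
  ring

lemma log_sub_log_le {k : ℕ} (hk : 0 < k) :
    log (k + 1) - log k ≤ 1 / (2 * k : ℝ) + 1 / (2 * (k + 1)) := by
  have hk' : (0 : ℝ) < k := by exact_mod_cast hk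
  rw [← log_div (by positivity) hk'.ne']
  have h1 : (1 : ℝ) ≤ (k + 1) / k := by rw [le_div_iff₀ hk']; linarith
  have h := self_le_sinh_iff.2 (log_nonneg h1)
  rw [sinh_eq, exp_neg, exp_log (by positivity)] at h
  refine h.trans (le_of_eq ?_)
  field_simp
  ring

lemma log_add_le_sum_odd_inv {k : ℕ} (hk : 0 < k) :
    log k + eulerMascheroniConstant + 2 * log 2 ≤
      2 * ∑ j ∈ Finset.range k, 1 / (2 * j + 1 : ℝ) := by
  obtain ⟨k, rfl⟩ := Nat.exists_eq_add_one.2 hk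
  let u : ℕ → ℝ := fun k => 2 * ∑ j ∈ Finset.range (k + 1), 1 / (2 * j + 1 : ℝ) - log (k + 1 : ℕ)
  have hu : Antitone u := antitone_nat_of_succ_le fun j => by
    have := two_div_le_log_sub_log (Nat.succ_pos j)
    simp only [u]
    rw [Finset.sum_range_succ]
    push_cast at *
    have h2 : 2 / (2 * ((j : ℝ) + 1) + 1) = 2 * (1 / (2 * ((j : ℝ) + 1) + 1)) := by ring
    linarith
  have hlim : Tendsto u atTop (𝓝 (eulerMascheroniConstant + 2 * log 2)) := by
    have h1 := (tendsto_harmonic_sub_log.comp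
      (tendsto_id.const_mul_atTop' (by norm_num : 0 < 2))).const_mul 2
    have h2 := ((h1.sub tendsto_harmonic_sub_log).comp (tendsto_add_atTop_nat 1)).add_const
      (2 * log 2)
    convert h2 using 2 with j
    · simp only [u, Function.comp, id]
      rw [sum_odd_inv_eq]
      push_cast
      rw [log_mul (by norm_num) (by positivity)]
      ring
    · ring
  have := hu.le_of_tendsto hlim k
  simp only [u] at this
  linarith

lemma harmonic_le_log_add {m : ℕ} (hm : 0 < m) :
    (harmonic m : ℝ) ≤ log m + eulerMascheroniConstant + 1 / (2 * m) := by
  obtain ⟨m, rfl⟩ := Nat.exists_eq_add_one.2 hm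
  let u : ℕ → ℝ := fun k => harmonic (k + 1) - log (k + 1 : ℕ) - 1 / (2 * (k + 1 : ℕ))
  have hu : Monotone u := monotone_nat_of_le_succ fun j => by
    have := log_sub_log_le (Nat.succ_pos j)
    simp only [u]
    rw [harmonic_succ (j + 1)]
    push_cast at *
    have h2 : ((j : ℝ) + 1 + 1)⁻¹ = 2 * (1 / (2 * ((j : ℝ) + 1 + 1))) := by field_simp
    linarith
  have hlim : Tendsto u atTop (𝓝 eulerMascheroniConstant) := by
    have h1 : Tendsto (fun m : ℕ => 1 / (2 * m : ℝ)) atTop (𝓝 0) := by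
      have := (tendsto_inv_atTop_nhds_zero_nat (𝕜 := ℝ)).const_mul (1 / 2)
      rw [mul_zero] at this
      refine this.congr fun m => ?_
      rw [one_div, one_div, mul_inv]
    have h2 := (tendsto_harmonic_sub_log.sub h1).comp (tendsto_add_atTop_nat 1)
    rw [sub_zero] at h2
    exact h2
  have := hu.ge_of_tendsto hlim m
  simp only [u] at this
  linarith

lemma log_centralFactorial_le (k : ℕ) :
    log ((2 * k).factorial / (4 ^ k * k.factorial)) ≤ 1 / 2 * log 2 + k * log k - k := by
  rcases k with _ | k
  · simp; positivity
  have h := Stirling.log_stirlingSeq'_antitone (show k ≤ 2 * k + 1 by omega)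
  simp only [Function.comp, Nat.succ_eq_add_one, Stirling.log_stirlingSeq_formula] at h
  rw [show 2 * k + 1 + 1 = 2 * (k + 1) by ring] at h
  have hp : (0 : ℝ) < ((k + 1 : ℕ) : ℝ) := by positivity
  generalize k + 1 = m at *
  push_cast at h
  rw [log_div (by positivity) (by positivity), log_mul (by positivity) (by positivity), log_pow,
    show (4 : ℝ) = 2 * 2 by norm_num, log_mul two_ne_zero two_ne_zero]
  rw [log_div (by positivity) (by positivity), log_div (by positivity) (by positivity), log_exp,
    log_mul two_ne_zero (by positivity), log_mul two_ne_zero (by positivity)] at h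
  linarith

lemma log_trigMoment_le (k l : ℕ) (h : 0 < k + l) :
    log (2 / π * trigMoment k l) ≤ k * log k + l * log l - (k + l) * log (k + l)
      - 1 / 2 * log (π * (k + l) / 2) := by
  rw [trigMoment_eq, log_div (by positivity) (by positivity), log_mul (by positivity)
    (by positivity)]
  have h1 := log_centralFactorial_le k
  have h2 := log_centralFactorial_le l
  have h3 := Stirling.le_log_factorial_stirling (n := k + l) h.ne'
  have hp : (0 : ℝ) < k + l := by exact_mod_cast h
  push_cast at h3
  rw [log_mul two_ne_zero pi_ne_zero] at h3
  rw [log_div (x := π * ((k : ℝ) + l)) (by positivity) two_ne_zero, log_mul pi_ne_zero hp.ne']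
  linarith

/-- A nonnegative lower bound (in nats) for the redundancy of `m` Bernoulli trials relative to
the arcsine mixture. -/
def bernoulliRedundancyBound (m : ℕ) : ℝ := max 0 (1 / 2 * log (π * m / 2) - 1 / 2)

lemma mul_le_posterior_log (k : ℕ) {m : ℕ} (hm : 0 < m) :
    k * (log k - log m - 1 / (2 * m)) ≤
      k * (2 * (-log 2 + ∑ j ∈ Finset.range k, 1 / (2 * j + 1 : ℝ) - harmonic m / 2)) := by
  rcases Nat.eq_zero_or_pos k with rfl | hk
  · simp
  refine mul_le_mul_of_nonneg_left ?_ (Nat.cast_nonneg k)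
  linarith [log_add_le_sum_odd_inv hk, harmonic_le_log_add hm]

lemma log_trigMoment_add_bound_le (k l : ℕ) :
    log (2 / π * trigMoment k l) + bernoulliRedundancyBound (k + l) ≤
      k * (2 * (-log 2 + ∑ j ∈ Finset.range k, 1 / (2 * j + 1 : ℝ) - harmonic (k + l) / 2)) +
      l * (2 * (-log 2 + ∑ j ∈ Finset.range l, 1 / (2 * j + 1 : ℝ) - harmonic (k + l) / 2)) := by
  rcases Nat.eq_zero_or_pos (k + l) with h0 | hpos
  · obtain ⟨rfl, rfl⟩ : k = 0 ∧ l = 0 := by omega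
    simp [trigMoment_zero_zero, bernoulliRedundancyBound]
  have hp : (0 : ℝ) < k + l := by exact_mod_cast hpos
  have key : log (2 / π * trigMoment k l) + (1 / 2 * log (π * (k + l : ℕ) / 2) - 1 / 2) ≤
      k * (2 * (-log 2 + ∑ j ∈ Finset.range k, 1 / (2 * j + 1 : ℝ) - harmonic (k + l) / 2)) +
      l * (2 * (-log 2 + ∑ j ∈ Finset.range l, 1 / (2 * j + 1 : ℝ) - harmonic (k + l) / 2)) := by
    refine le_trans ?_ (add_le_add (mul_le_posterior_log k hpos) (mul_le_posterior_log l hpos))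
    have h1 := log_trigMoment_le k l hpos
    have h2 : ((k : ℝ) + l) * (1 / (2 * (k + l))) = 1 / 2 := by field_simp
    push_cast
    linarith
  rcases Nat.lt_or_ge (k + l) 2 with h2 | h2
  · have hb : bernoulliRedundancyBound (k + l) = 0 := by
      rw [show k + l = 1 by omega, bernoulliRedundancyBound]
      refine max_eq_left ?_
      have : log (π * (1 : ℕ) / 2) ≤ 1 := by
        rw [← log_exp 1]
        refine log_le_log (by positivity) ?_
        have := pi_lt_d2
        have := exp_one_gt_d9
        push_cast
        linarith
      linarith
    rw [hb]
    have hl := log_two_lt_d9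
    have h4 : log (2 / π * trigMoment k l) = - log 2 := by
      rcases (by omega : (k = 1 ∧ l = 0) ∨ (k = 0 ∧ l = 1)) with ⟨rfl, rfl⟩ | ⟨rfl, rfl⟩ <;>
      · rw [trigMoment_eq, ← log_inv]
        norm_num [Nat.factorial]
    rw [h4]
    rcases (by omega : (k = 1 ∧ l = 0) ∨ (k = 0 ∧ l = 1)) with ⟨rfl, rfl⟩ | ⟨rfl, rfl⟩ <;>
    · simp
      linarith
  · rw [bernoulliRedundancyBound, max_eq_right]
    · exact key
    · have : 1 ≤ log (π * (k + l : ℕ) / 2) := by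
        rw [← log_exp 1]
        refine log_le_log (by positivity) ?_
        have := pi_gt_three
        have := exp_one_lt_d9
        have h2' : (2 : ℝ) ≤ (k + l : ℕ) := by exact_mod_cast h2
        nlinarith
      linarith

lemma pow_mul_pow_mul_log (a b : ℝ) (k l : ℕ) :
    a ^ (2 * k) * b ^ (2 * l) * log (a ^ (2 * k) * b ^ (2 * l)) =
      2 * k * (a ^ (2 * k) * b ^ (2 * l) * log a) +
        2 * l * (a ^ (2 * k) * b ^ (2 * l) * log b) := by
  by_cases ha : a ^ (2 * k) = 0
  · simp [ha]
  by_cases hb : b ^ (2 * l) = 0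
  · simp [hb]
  rw [log_mul ha hb, log_pow, log_pow]
  push_cast
  ring

/-- The law of an angle that is uniform on a quarter period; its squared sine has the arcsine
law. -/
def arcsineAngle : Measure ℝ :=
  ENNReal.ofReal (2 / π) • volume.restrict (Set.Ioc 0 (π / 2))

instance : IsProbabilityMeasure arcsineAngle := ⟨by
  simp only [arcsineAngle, Measure.smul_apply, Measure.restrict_apply_univ, Real.volume_Ioc,
    smul_eq_mul]
  rw [← ENNReal.ofReal_mul (by positivity), sub_zero, ← ENNReal.ofReal_one]
  congr 1
  field_simp⟩

lemma integral_arcsineAngle (g : ℝ → ℝ) :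
    ∫ x, g x ∂arcsineAngle = 2 / π * ∫ x in (0 : ℝ)..(π / 2), g x := by
  rw [arcsineAngle, MeasureTheory.integral_smul_measure,
    intervalIntegral.integral_of_le (by positivity),
    ENNReal.toReal_ofReal (by positivity), smul_eq_mul]

lemma integral_trig_arcsineAngle (k l : ℕ) :
    ∫ x, sin x ^ (2 * k) * cos x ^ (2 * l) ∂arcsineAngle = 2 / π * trigMoment k l :=
  integral_arcsineAngle _

/-- The Bernoulli mixture with arcsine prior has redundancy at least
`bernoulliRedundancyBound`, contribution by contribution. -/
lemma arcsine_mixture_redundancy (k l : ℕ) :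
    2 / π * trigMoment k l *
        (log (2 / π * trigMoment k l) + bernoulliRedundancyBound (k + l)) ≤
      ∫ x, sin x ^ (2 * k) * cos x ^ (2 * l) * log (sin x ^ (2 * k) * cos x ^ (2 * l))
        ∂arcsineAngle := by
  have hcos : IntervalIntegrable (fun x => sin x ^ (2 * k) * cos x ^ (2 * l) * log (cos x))
      volume 0 (π / 2) :=
    (intervalIntegrable_log_cos (a := 0) (b := π / 2)).continuousOn_mul
      (Continuous.continuousOn (by fun_prop))
  simp_rw [pow_mul_pow_mul_log]
  rw [integral_arcsineAngle, intervalIntegral.integral_add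
    ((intervalIntegrable_trig_mul_log_sin k l _ _).const_mul _) (hcos.const_mul _),
    intervalIntegral.integral_const_mul, intervalIntegral.integral_const_mul,
    integral_trig_mul_log_cos]
  change _ ≤ 2 / π * (2 * k * logTrigMoment k l + _)
  rw [logTrigMoment_eq k l, logTrigMoment_eq l k, trigMoment_comm l k, add_comm l k]
  have h := mul_le_mul_of_nonneg_left (log_trigMoment_add_bound_le k l)
    (mul_nonneg (by positivity : 0 ≤ 2 / π) (trigMoment_pos k l).le)
  refine h.trans (le_of_eq ?_)
  ring

end ArcsinePrior

section Mixtures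
open MeasureTheory

lemma sum_fin_succ_pi {α : Type*} [Fintype α] (n : ℕ) (F : (Fin (n + 1) → α) → ℝ) :
    ∑ x, F x = ∑ a, ∑ x : Fin n → α, F (Fin.cons a x) := by
  rw [← Fintype.sum_prod_type']
  exact (Fintype.sum_equiv (Fin.consEquiv fun _ => α) _ _ fun _ => rfl).symm

lemma sum_word_prob {α : Type*} [Fintype α] (n : ℕ) {r : α → ℝ} (hr : ∑ a, r a = 1) :
    ∑ x : Fin n → α, ∏ t, r (x t) = 1 := by
  induction n with
  | zero => simp
  | succ n ih =>
    rw [sum_fin_succ_pi]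
    simp only [Fin.prod_univ_succ, Fin.cons_zero, Fin.cons_succ, ← Finset.mul_sum, ih, mul_one, hr]

lemma sum_word_mean {α : Type*} [Fintype α] (n : ℕ) {r y : α → ℝ} (hr : ∑ a, r a = 1)
    (hy : ∑ a, r a * y a = 0) :
    ∑ x : Fin n → α, (∏ t, r (x t)) * ∑ t, y (x t) = 0 := by
  induction n with
  | zero => simp
  | succ n ih =>
    rw [sum_fin_succ_pi]
    have h : ∀ a, ∑ x : Fin n → α, (r a * ∏ t, r (x t)) * (y a + ∑ t, y (x t)) = r a * y a := by
      intro a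
      calc _ = r a * y a * ∑ x : Fin n → α, ∏ t, r (x t)
            + r a * ∑ x : Fin n → α, (∏ t, r (x t)) * ∑ t, y (x t) := by
            rw [Finset.mul_sum, Finset.mul_sum, ← Finset.sum_add_distrib]
            exact Finset.sum_congr rfl fun x _ => by ring
        _ = _ := by rw [sum_word_prob n hr, ih]; ring
    simp only [Fin.prod_univ_succ, Fin.sum_univ_succ, Fin.cons_zero, Fin.cons_succ, h, hy]

lemma sum_word_variance {α : Type*} [Fintype α] (n : ℕ) {r y : α → ℝ} (hr : ∑ a, r a = 1)
    (hy : ∑ a, r a * y a = 0) :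
    ∑ x : Fin n → α, (∏ t, r (x t)) * (∑ t, y (x t)) ^ 2 = n * ∑ a, r a * y a ^ 2 := by
  induction n with
  | zero => simp
  | succ n ih =>
    rw [sum_fin_succ_pi]
    have h : ∀ a, ∑ x : Fin n → α, (r a * ∏ t, r (x t)) * (y a + ∑ t, y (x t)) ^ 2 =
        r a * y a ^ 2 + r a * (n * ∑ a, r a * y a ^ 2) := by
      intro a
      calc _ = r a * y a ^ 2 * ∑ x : Fin n → α, ∏ t, r (x t)
            + 2 * (r a * y a) * (∑ x : Fin n → α, (∏ t, r (x t)) * ∑ t, y (x t))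
            + r a * ∑ x : Fin n → α, (∏ t, r (x t)) * (∑ t, y (x t)) ^ 2 := by
            rw [Finset.mul_sum, Finset.mul_sum, Finset.mul_sum, ← Finset.sum_add_distrib,
              ← Finset.sum_add_distrib]
            exact Finset.sum_congr rfl fun x _ => by ring
        _ = _ := by rw [sum_word_prob n hr, sum_word_mean n hr hy, ih]; ring
    simp only [Fin.prod_univ_succ, Fin.sum_univ_succ, Fin.cons_zero, Fin.cons_succ, h]
    rw [Finset.sum_add_distrib, ← Finset.sum_mul, hr]
    push_cast
    ring

/-- Cantelli's inequality for the number of letters of a word that lie in a given set. -/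
lemma cantelli_count {α : Type*} [Fintype α] (n : ℕ) (hn : 0 < n) {r : α → ℝ}
    (hr0 : ∀ a, 0 ≤ r a) (hr : ∑ a, r a = 1) (A : α → Prop) [DecidablePred A] {w lam : ℝ}
    (hw : ∑ a, (if A a then r a else 0) = w) (hw0 : 0 < w) (hlam : 0 < lam) :
    1 / (1 + 1 / (lam ^ 2 * n * w)) ≤ ∑ x : Fin n → α, (∏ t, r (x t)) *
      if (1 - lam) * n * w ≤ (Finset.univ.filter fun t => A (x t)).card then 1 else 0 := by
  have hn' : (0 : ℝ) < n := by exact_mod_cast hn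
  set y : α → ℝ := fun a => (if A a then 1 else 0) - w with hydef
  have hw' : ∑ a, r a * (if A a then 1 else 0) = w := by simpa using hw
  have hy : ∑ a, r a * y a = 0 := by
    simp only [hydef, mul_sub, Finset.sum_sub_distrib, ← Finset.sum_mul]
    rw [hw', hr]
    ring
  have hv : ∑ a, r a * y a ^ 2 = w - w ^ 2 := by
    have h : ∀ a, r a * y a ^ 2 = (1 - 2 * w) * (r a * (if A a then 1 else 0)) + w ^ 2 * r a := by
      intro a
      simp only [hydef]
      split_ifs <;> ring
    simp only [h]
    rw [Finset.sum_add_distrib, ← Finset.mul_sum, ← Finset.mul_sum, hw', hr]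
    ring
  have hsum : ∀ x : Fin n → α,
      ∑ t, y (x t) = (Finset.univ.filter fun t => A (x t)).card - n * w := by
    intro x
    simp [hydef, Finset.sum_sub_distrib]
  set b : ℝ := 1 / lam
  set d : ℝ := lam * n * w + b with hd
  have hb0 : 0 < b := by positivity
  have hd0 : 0 < d := by positivity
  have hpt : ∀ x : Fin n → α, (∏ t, r (x t)) * (1 - (∑ t, y (x t) - b) ^ 2 / d ^ 2) ≤
      (∏ t, r (x t)) *
        if (1 - lam) * n * w ≤ (Finset.univ.filter fun t => A (x t)).card then 1 else 0 := by
    intro x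
    refine mul_le_mul_of_nonneg_left ?_ (Finset.prod_nonneg fun t _ => hr0 _)
    split_ifs with hx
    · have : 0 ≤ (∑ t, y (x t) - b) ^ 2 / d ^ 2 := by positivity
      linarith
    · rw [sub_nonpos, le_div_iff₀ (by positivity), one_mul, hsum]
      have : d ≤ -((Finset.univ.filter fun t => A (x t)).card - n * w - b) := by
        push Not at hx
        rw [hd]
        linarith
      nlinarith
  refine le_trans ?_ (Finset.sum_le_sum fun x _ => hpt x)
  have hexp : ∑ x : Fin n → α, (∏ t, r (x t)) * (1 - (∑ t, y (x t) - b) ^ 2 / d ^ 2) =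
      1 - (n * (w - w ^ 2) + b ^ 2) / d ^ 2 := by
    calc _ = (1 - b ^ 2 / d ^ 2) * ∑ x : Fin n → α, ∏ t, r (x t)
          + 2 * b / d ^ 2 * (∑ x : Fin n → α, (∏ t, r (x t)) * ∑ t, y (x t))
          - 1 / d ^ 2 * ∑ x : Fin n → α, (∏ t, r (x t)) * (∑ t, y (x t)) ^ 2 := by
          rw [Finset.mul_sum, Finset.mul_sum, Finset.mul_sum, ← Finset.sum_add_distrib,
            ← Finset.sum_sub_distrib]
          exact Finset.sum_congr rfl fun x _ => by ring
      _ = _ := by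
          rw [sum_word_prob n hr, sum_word_mean n hr hy, sum_word_variance n hr hy, hv]
          ring
  rw [hexp]
  have h1 : (n * (w - w ^ 2) + b ^ 2) / d ^ 2 ≤ (n * w + b ^ 2) / d ^ 2 := by
    gcongr
    nlinarith [sq_nonneg w]
  refine le_trans (le_of_eq ?_) (sub_le_sub_left h1 1)
  simp only [hd, b]
  field_simp
  ring

/-- The maximal divergence from a family dominates the Bayes redundancy of every prior on it. -/
lemma bayes_redundancy_le {Ω T : Type*} [Fintype Ω] [MeasurableSpace T] (μ : Measure T)
    [IsProbabilityMeasure μ] (P : T → Ω → ℝ) (hmeas : ∀ ω, Measurable fun t => P t ω)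
    (h0 : ∀ t ω, 0 ≤ P t ω) (h1 : ∀ t, ∑ ω, P t ω = 1) (q : Ω → ℝ) (hq0 : ∀ ω, 0 ≤ q ω)
    (hq1 : ∑ ω, q ω ≤ 1) (hac : ∀ t ω, q ω = 0 → P t ω = 0) (S : ℝ)
    (hS : ∀ t, ∑ ω, P t ω * Real.log (P t ω / q ω) ≤ S) :
    ∑ ω, (∫ t, P t ω * Real.log (P t ω) ∂μ
      - (∫ t, P t ω ∂μ) * Real.log (∫ t, P t ω ∂μ)) ≤ S := by
  have hle : ∀ t ω, P t ω ≤ 1 := fun t ω => by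
    rw [← h1 t]
    exact Finset.single_le_sum (fun ω _ => h0 t ω) (Finset.mem_univ ω)
  have hInt : ∀ ω, Integrable (fun t => P t ω) μ := fun ω =>
    Integrable.of_bound (hmeas ω).aestronglyMeasurable 1
      (Filter.Eventually.of_forall fun t => by
        rw [Real.norm_eq_abs, abs_of_nonneg (h0 t ω)]; exact hle t ω)
  have hintlog : ∀ ω, Integrable (fun t => P t ω * Real.log (P t ω)) μ := fun ω =>
    Integrable.of_bound
      ((hmeas ω).mul (Real.measurable_log.comp (hmeas ω))).aestronglyMeasurable 1
      (Filter.Eventually.of_forall fun t => by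
        have hneg := Real.negMulLog_nonneg (h0 t ω) (hle t ω)
        have hub : Real.negMulLog (P t ω) ≤ 1 - P t ω := by
          rcases (h0 t ω).eq_or_lt with h | h
          · simp [← h]
          have h2 := Real.one_sub_inv_le_log_of_pos h
          have h3 := mul_le_mul_of_nonneg_left h2 h.le
          rw [mul_sub, mul_inv_cancel₀ h.ne'] at h3
          rw [Real.negMulLog]
          linarith
        rw [Real.negMulLog] at hneg hub
        rw [Real.norm_eq_abs, abs_le]
        constructor <;> linarith [h0 t ω])
  have hsplit : ∀ t ω, P t ω * Real.log (P t ω / q ω) =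
      P t ω * Real.log (P t ω) - P t ω * Real.log (q ω) := by
    intro t ω
    by_cases hP : P t ω = 0
    · simp [hP]
    · rw [Real.log_div hP fun h => hP (hac t ω h), mul_sub]
  have havg : ∑ ω, (∫ t, P t ω * Real.log (P t ω) ∂μ - (∫ t, P t ω ∂μ) * Real.log (q ω)) ≤ S := by
    have hterm : ∀ ω, Integrable
        (fun t => P t ω * Real.log (P t ω) - P t ω * Real.log (q ω)) μ :=
      fun ω => (hintlog ω).sub ((hInt ω).mul_const _)
    calc _ = ∫ t, ∑ ω, (P t ω * Real.log (P t ω) - P t ω * Real.log (q ω)) ∂μ := by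
          rw [integral_finsetSum _ fun ω _ => hterm ω]
          refine Finset.sum_congr rfl fun ω _ => ?_
          rw [integral_sub (hintlog ω) ((hInt ω).mul_const _), integral_mul_const]
      _ ≤ ∫ _, S ∂μ := by
          refine integral_mono (integrable_finsetSum _ fun ω _ => hterm ω) (integrable_const _)
            fun t => ?_
          simpa only [hsplit] using hS t
      _ = S := by simp
  have hM1 : ∑ ω, ∫ t, P t ω ∂μ = 1 := by
    rw [← integral_finsetSum _ fun ω _ => hInt ω]
    simp [h1]
  have hgibbs : ∀ ω, (∫ t, P t ω ∂μ) * Real.log (q ω) + (∫ t, P t ω ∂μ) - q ω ≤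
      (∫ t, P t ω ∂μ) * Real.log (∫ t, P t ω ∂μ) := by
    intro ω
    have hM0 : 0 ≤ ∫ t, P t ω ∂μ := integral_nonneg fun t => h0 t ω
    rcases (hq0 ω).eq_or_lt with hq | hq
    · have : ∀ t, P t ω = 0 := fun t => hac t ω hq.symm
      simp [this, ← hq]
    rcases hM0.eq_or_lt with hM | hM
    · simp [← hM, hq.le]
    have h2 := mul_le_mul_of_nonneg_left
      (Real.log_le_sub_one_of_pos (div_pos hq hM)) hM.le
    rw [Real.log_div hq.ne' hM.ne', mul_sub, mul_sub, mul_div_cancel₀ _ hM.ne'] at h2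
    linarith
  have hsum := Finset.sum_le_sum fun ω (_ : ω ∈ Finset.univ) => hgibbs ω
  rw [Finset.sum_sub_distrib, Finset.sum_add_distrib, hM1] at hsum
  rw [Finset.sum_sub_distrib] at havg ⊢
  linarith

lemma prod_mul_log_prod {ι : Type*} [Fintype ι] [DecidableEq ι] (g : ι → ℝ) :
    (∏ i, g i) * Real.log (∏ i, g i) =
      ∑ i, ∏ j, if j = i then g j * Real.log (g j) else g j := by
  by_cases h : ∀ i, g i ≠ 0
  · rw [Real.log_prod fun i _ => h i, Finset.mul_sum]
    refine Finset.sum_congr rfl fun i _ => ?_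
    rw [← Finset.mul_prod_erase _ _ (Finset.mem_univ i),
      ← Finset.mul_prod_erase Finset.univ (fun j => if j = i then _ else _) (Finset.mem_univ i),
      Finset.prod_congr rfl fun j hj => if_neg (Finset.ne_of_mem_erase hj)]
    simp only [if_true]
    ring
  · push Not at h
    obtain ⟨a, ha⟩ := h
    rw [Finset.prod_eq_zero (Finset.mem_univ a) ha, zero_mul]
    symm
    refine Finset.sum_eq_zero fun i _ => Finset.prod_eq_zero (Finset.mem_univ a) ?_
    simp [ha]

/-- Lower bounds for Bayes redundancies add up over independent coordinates of the prior. -/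
lemma product_mixture_redundancy {ι : Type*} [Fintype ι] {ν : Measure ℝ} [IsProbabilityMeasure ν]
    (g : ι → ℝ → ℝ) (hg : ∀ i, Continuous (g i)) (hg0 : ∀ i x, 0 ≤ g i x)
    (hg1 : ∀ i x, g i x ≤ 1) (b : ι → ℝ) (hK : ∀ i, 0 < ∫ x, g i x ∂ν)
    (hb : ∀ i, (∫ x, g i x ∂ν) * (Real.log (∫ x, g i x ∂ν) + b i) ≤
      ∫ x, g i x * Real.log (g i x) ∂ν)
    {W : ℝ} (hW : 0 < W) :
    (∫ x : ι → ℝ, W * ∏ i, g i (x i) ∂(Measure.pi fun _ => ν)) * ∑ i, b i ≤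
      ∫ x : ι → ℝ, (W * ∏ i, g i (x i)) * Real.log (W * ∏ i, g i (x i)) ∂(Measure.pi fun _ => ν)
      - (∫ x : ι → ℝ, W * ∏ i, g i (x i) ∂(Measure.pi fun _ => ν)) *
        Real.log (∫ x : ι → ℝ, W * ∏ i, g i (x i) ∂(Measure.pi fun _ => ν)) := by
  classical
  have hInt : ∀ i, Integrable (g i) ν := fun i =>
    Integrable.of_bound (hg i).aestronglyMeasurable 1 (Filter.Eventually.of_forall fun x => by
      rw [Real.norm_eq_abs, abs_of_nonneg (hg0 i x)]; exact hg1 i x)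
  have hintlog : ∀ i, Integrable (fun x => g i x * Real.log (g i x)) ν := fun i => by
    obtain ⟨C, hC⟩ := (isCompact_Icc (a := (0 : ℝ)) (b := 1)).exists_bound_of_continuousOn
      Real.continuous_mul_log.continuousOn
    exact Integrable.of_bound (Real.continuous_mul_log.comp (hg i)).aestronglyMeasurable C
      (Filter.Eventually.of_forall fun x => hC _ ⟨hg0 i x, hg1 i x⟩)
  have hM : ∫ x : ι → ℝ, W * ∏ i, g i (x i) ∂(Measure.pi fun _ => ν) =
      W * ∏ i, ∫ x, g i x ∂ν := by
    rw [integral_const_mul, integral_fintype_prod_eq_prod]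
  have hprodint : Integrable (fun x : ι → ℝ => ∏ i, g i (x i)) (Measure.pi fun _ => ν) :=
    Integrable.fintype_prod hInt
  have hite : ∀ i j, Integrable (fun x => if j = i then g j x * Real.log (g j x) else g j x) ν := by
    intro i j
    split_ifs
    · exact hintlog j
    · exact hInt j
  have hiteint : ∀ i, Integrable (fun x : ι → ℝ =>
      ∏ j, if j = i then g j (x j) * Real.log (g j (x j)) else g j (x j))
      (Measure.pi fun _ => ν) := fun i => Integrable.fintype_prod (hite i)
  have hpt : ∀ x : ι → ℝ, (W * ∏ i, g i (x i)) * Real.log (W * ∏ i, g i (x i)) =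
      W * Real.log W * (∏ i, g i (x i)) +
        W * ∑ i, ∏ j, if j = i then g j (x j) * Real.log (g j (x j)) else g j (x j) := by
    intro x
    rw [← prod_mul_log_prod]
    by_cases h : ∏ i, g i (x i) = 0
    · simp [h]
    · rw [Real.log_mul hW.ne' h]
      ring
  have hlogint : ∫ x : ι → ℝ, (W * ∏ i, g i (x i)) * Real.log (W * ∏ i, g i (x i))
      ∂(Measure.pi fun _ => ν) = W * Real.log W * (∏ i, ∫ x, g i x ∂ν) +
        W * ∑ i, ∏ j, ∫ x, (if j = i then g j x * Real.log (g j x) else g j x) ∂ν := by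
    simp_rw [hpt]
    rw [integral_add (hprodint.const_mul _)
      ((integrable_finsetSum _ fun i _ => hiteint i).const_mul _),
      integral_const_mul, integral_const_mul, integral_fintype_prod_eq_prod,
      integral_finsetSum _ fun i _ => hiteint i]
    congr 2
    refine Finset.sum_congr rfl fun i _ => ?_
    exact integral_fintype_prod_eq_prod
      (fun j x => if j = i then g j x * Real.log (g j x) else g j x)
  have hterm : ∀ i, (∏ j, ∫ x, g j x ∂ν) * (Real.log (∫ x, g i x ∂ν) + b i) ≤
      ∏ j, ∫ x, (if j = i then g j x * Real.log (g j x) else g j x) ∂ν := by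
    intro i
    have herase : ∏ j ∈ Finset.univ.erase i,
        ∫ x, (if j = i then g j x * Real.log (g j x) else g j x) ∂ν =
        ∏ j ∈ Finset.univ.erase i, ∫ x, g j x ∂ν :=
      Finset.prod_congr rfl fun j hj => by simp only [if_neg (Finset.ne_of_mem_erase hj)]
    rw [← Finset.mul_prod_erase _ _ (Finset.mem_univ i),
      ← Finset.mul_prod_erase Finset.univ (fun j => ∫ x, (if j = i then _ else _) ∂ν)
        (Finset.mem_univ i), herase]
    simp only [if_true]
    have h := mul_le_mul_of_nonneg_right (hb i)
      (Finset.prod_nonneg fun j (_ : j ∈ Finset.univ.erase i) => (hK j).le)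
    linarith
  have hprod0 : 0 < ∏ i, ∫ x, g i x ∂ν := Finset.prod_pos fun i _ => hK i
  rw [hlogint, hM, Real.log_mul hW.ne' hprod0.ne', Real.log_prod fun i _ => (hK i).ne']
  have hsum := mul_le_mul_of_nonneg_left
    (Finset.sum_le_sum fun i (_ : i ∈ Finset.univ) => hterm i) hW.le
  rw [← Finset.mul_sum, Finset.sum_add_distrib] at hsum
  linarith

end Mixtures

section PairedLetters
open MeasureTheory

/-- The law on letters `(i, b)` that puts mass `w i` on the `i`-th pair and splits it according to
the angle `x i`. -/
def pairLaw {ι : Type*} (w : ι → ℝ) (x : ι → ℝ) : ι × Bool → ℝ :=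
  fun a => w a.1 * if a.2 then Real.sin (x a.1) ^ 2 else Real.cos (x a.1) ^ 2

variable {ι : Type*} {w : ι → ℝ}

lemma pairLaw_nonneg (hw : ∀ i, 0 ≤ w i) (x : ι → ℝ) (a : ι × Bool) : 0 ≤ pairLaw w x a := by
  unfold pairLaw
  have := hw a.1
  split_ifs <;> positivity

lemma pairLaw_le (hw : ∀ i, 0 ≤ w i) (x : ι → ℝ) (a : ι × Bool) : pairLaw w x a ≤ w a.1 := by
  unfold pairLaw
  refine mul_le_of_le_one_right (hw _) ?_
  split_ifs
  · exact Real.sin_sq_le_one _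
  · exact Real.cos_sq_le_one _

lemma pairLaw_true_add_false (x : ι → ℝ) (i : ι) :
    pairLaw w x (i, true) + pairLaw w x (i, false) = w i := by
  simp only [pairLaw]
  have := Real.sin_sq_add_cos_sq (x i)
  simp only [if_true, Bool.false_eq_true, if_false]
  linear_combination w i * this

lemma card_filter_fst [DecidableEq ι] {n : ℕ} (y : Fin n → ι × Bool) (i : ι) :
    (Finset.univ.filter fun t => y t = (i, true)).card +
      (Finset.univ.filter fun t => y t = (i, false)).card =
      (Finset.univ.filter fun t => (y t).1 = i).card := by
  rw [← Finset.card_union_of_disjoint, ← Finset.filter_or]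
  · congr 1
    ext t
    rcases h : y t with ⟨j, _ | _⟩ <;> simp [h]
  · rw [Finset.disjoint_filter]
    intro t _ h1 h2
    simp [h1] at h2

variable [Fintype ι]

lemma sum_pairLaw (hw1 : ∑ i, w i = 1) (x : ι → ℝ) : ∑ a, pairLaw w x a = 1 := by
  rw [Fintype.sum_prod_type]
  simp only [Fintype.sum_bool, pairLaw_true_add_false, hw1]

lemma sum_pairLaw_fst [DecidableEq ι] (x : ι → ℝ) (i : ι) :
    ∑ a : ι × Bool, (if a.1 = i then pairLaw w x a else 0) = w i := by
  rw [Fintype.sum_prod_type]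
  simp only [Fintype.sum_bool]
  rw [Finset.sum_eq_single i]
  · simpa using pairLaw_true_add_false x i
  · intro j _ hj
    simp [hj]
  · simp

lemma prod_pairLaw [DecidableEq ι] {n : ℕ} (x : ι → ℝ) (y : Fin n → ι × Bool) :
    ∏ t, pairLaw w x (y t) = (∏ t, w (y t).1) *
      ∏ i, Real.sin (x i) ^ (2 * (Finset.univ.filter fun t => y t = (i, true)).card) *
        Real.cos (x i) ^ (2 * (Finset.univ.filter fun t => y t = (i, false)).card) := by
  simp only [pairLaw]
  rw [Finset.prod_mul_distrib]
  congr 1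
  rw [← Finset.prod_fiberwise' Finset.univ y
    (fun a => if a.2 then Real.sin (x a.1) ^ 2 else Real.cos (x a.1) ^ 2), Fintype.prod_prod_type]
  simp [Finset.prod_const, ← pow_mul]

/-- If the laws `pairLaw w x` all have divergence at most `S` (in nats) to a common sub-probability
on words, then `S` is at least the sum over the pairs of the Bernoulli redundancies for a typical
number of visits. -/
lemma sum_le_of_pairLaw_divergence_le (hw : ∀ i, 0 < w i) (hw1 : ∑ i, w i = 1) {n : ℕ}
    (hn : 0 < n) {lam : ℝ} (hlam0 : 0 < lam) (hlam1 : lam < 1) (q : (Fin n → ι × Bool) → ℝ)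
    (hq0 : ∀ y, 0 ≤ q y) (hq1 : ∑ y, q y ≤ 1)
    (hac : ∀ x y, q y = 0 → ∏ t, pairLaw w x (y t) = 0) {S : ℝ}
    (hS : ∀ x, ∑ y, (∏ t, pairLaw w x (y t)) * Real.log ((∏ t, pairLaw w x (y t)) / q y) ≤ S) :
    ∑ i, 1 / (1 + 1 / (lam ^ 2 * n * w i)) *
      max 0 (1 / 2 * Real.log (Real.pi * ((1 - lam) * n * w i) / 2) - 1 / 2) ≤ S := by
  classical
  have hn' : (0 : ℝ) < n := by exact_mod_cast hn
  have hw0 : ∀ i, 0 ≤ w i := fun i => (hw i).le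
  set μ : Measure (ι → ℝ) := Measure.pi fun _ => arcsineAngle
  set N : (Fin n → ι × Bool) → ι → ℕ := fun y i => (Finset.univ.filter fun t => (y t).1 = i).card
  have hcontP : ∀ y : Fin n → ι × Bool, Continuous fun x => ∏ t, pairLaw w x (y t) := by
    intro y
    simp only [prod_pairLaw]
    fun_prop
  have hP0 : ∀ x (y : Fin n → ι × Bool), 0 ≤ ∏ t, pairLaw w x (y t) :=
    fun x y => Finset.prod_nonneg fun t _ => pairLaw_nonneg hw0 x _
  have hP1 : ∀ x, ∑ y : Fin n → ι × Bool, ∏ t, pairLaw w x (y t) = 1 :=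
    fun x => sum_word_prob n (sum_pairLaw hw1 x)
  have hPint : ∀ y : Fin n → ι × Bool, Integrable (fun x => ∏ t, pairLaw w x (y t)) μ := fun y =>
    Integrable.of_bound (hcontP y).aestronglyMeasurable 1 (Filter.Eventually.of_forall fun x => by
      rw [Real.norm_eq_abs, abs_of_nonneg (hP0 x y), ← hP1 x]
      exact Finset.single_le_sum (fun y _ => hP0 x y) (Finset.mem_univ y))
  have hbayes := bayes_redundancy_le μ (fun x y => ∏ t, pairLaw w x (y t))
    (fun y => (hcontP y).measurable) hP0 hP1 q hq0 hq1 hac S hS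
  have hword : ∀ y : Fin n → ι × Bool,
      (∫ x, ∏ t, pairLaw w x (y t) ∂μ) * ∑ i, bernoulliRedundancyBound (N y i) ≤
      ∫ x, (∏ t, pairLaw w x (y t)) * Real.log (∏ t, pairLaw w x (y t)) ∂μ
      - (∫ x, ∏ t, pairLaw w x (y t) ∂μ) * Real.log (∫ x, ∏ t, pairLaw w x (y t) ∂μ) := by
    intro y
    simp only [prod_pairLaw]
    refine product_mixture_redundancy (ν := arcsineAngle)
      (fun i s => Real.sin s ^ (2 * (Finset.univ.filter fun t => y t = (i, true)).card) *
        Real.cos s ^ (2 * (Finset.univ.filter fun t => y t = (i, false)).card))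
      (fun i => by fun_prop) (fun i s => ?_) (fun i s => ?_)
      (fun i => bernoulliRedundancyBound (N y i)) (fun i => ?_) (fun i => ?_)
      (Finset.prod_pos fun t _ => hw _)
    · rw [pow_mul, pow_mul]
      positivity
    · rw [pow_mul, pow_mul]
      exact mul_le_one₀ (pow_le_one₀ (sq_nonneg _) (Real.sin_sq_le_one _)) (by positivity)
        (pow_le_one₀ (sq_nonneg _) (Real.cos_sq_le_one _))
    · rw [integral_trig_arcsineAngle]
      have := trigMoment_pos (Finset.univ.filter fun t => y t = (i, true)).card
        (Finset.univ.filter fun t => y t = (i, false)).card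
      have := Real.pi_pos
      positivity
    · have hcard : N y i = (Finset.univ.filter fun t => y t = (i, true)).card +
          (Finset.univ.filter fun t => y t = (i, false)).card := by
        simp only [N]
        convert (card_filter_fst y i).symm
      rw [integral_trig_arcsineAngle, hcard]
      exact arcsine_mixture_redundancy _ _
  refine le_trans ?_ hbayes
  refine le_trans ?_ (Finset.sum_le_sum fun y _ => hword y)
  simp_rw [Finset.mul_sum]
  rw [Finset.sum_comm]
  refine Finset.sum_le_sum fun i _ => ?_
  set m := max 0 (1 / 2 * Real.log (Real.pi * ((1 - lam) * n * w i) / 2) - 1 / 2)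
  have hm0 : 0 ≤ m := le_max_left _ _
  have hpos : 0 < (1 - lam) * n * w i := mul_pos (mul_pos (by linarith) hn') (hw i)
  have hcount : ∀ y : Fin n → ι × Bool,
      (if (1 - lam) * n * w i ≤ N y i then 1 else 0) * m ≤ bernoulliRedundancyBound (N y i) := by
    intro y
    split_ifs with h
    · rw [one_mul]
      refine max_le_max le_rfl ?_
      have hlog : Real.log (Real.pi * ((1 - lam) * n * w i) / 2) ≤
          Real.log (Real.pi * N y i / 2) :=
        Real.log_le_log (by have := Real.pi_pos; positivity) (by have := Real.pi_pos; gcongr)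
      linarith
    · rw [zero_mul]
      exact le_max_left _ _
  calc 1 / (1 + 1 / (lam ^ 2 * n * w i)) * m
      = ∫ _, 1 / (1 + 1 / (lam ^ 2 * n * w i)) * m ∂μ := by simp
    _ ≤ ∫ x, ∑ y : Fin n → ι × Bool,
          (∏ t, pairLaw w x (y t)) * bernoulliRedundancyBound (N y i) ∂μ := by
        refine integral_mono (integrable_const _)
          (integrable_finsetSum _ fun y _ => (hPint y).mul_const _) fun x => ?_
        have hc := mul_le_mul_of_nonneg_right (cantelli_count n hn (pairLaw_nonneg hw0 x)
          (sum_pairLaw hw1 x) (fun a => a.1 = i) (sum_pairLaw_fst x i) (hw i) hlam0) hm0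
        refine hc.trans ?_
        rw [Finset.sum_mul]
        refine Finset.sum_le_sum fun y _ => ?_
        rw [mul_assoc]
        exact mul_le_mul_of_nonneg_left (hcount y) (hP0 x y)
    _ = ∑ y : Fin n → ι × Bool,
          (∫ x, ∏ t, pairLaw w x (y t) ∂μ) * bernoulliRedundancyBound (N y i) := by
        rw [integral_finsetSum _ fun y _ => (hPint y).mul_const _]
        simp only [integral_mul_const]

end PairedLetters

section Envelope

lemma sum_log_le_of_klDiv2_le {α β : Type*} [Fintype α] {e : α → β} (he : Function.Injective e)
    {P Q : β → ℝ} (hP : IsPmf P) (hsupp : ∀ b, b ∉ Set.range e → P b = 0) (hQ : IsPmf Q) {s : ℝ}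
    (hs0 : 0 ≤ s) (hs : klDiv2 P Q ≤ ENNReal.ofReal s) :
    (∀ b, Q b = 0 → P b = 0) ∧
      ∑ a, P (e a) * Real.log (P (e a) / Q (e a)) ≤ s * Real.log 2 := by
  have hlog2 : 0 < Real.log 2 := Real.log_pos one_lt_two
  rw [klDiv2] at hs
  split_ifs at hs with hex
  · exact absurd hs (by simp)
  push Not at hex
  have hac : ∀ b, Q b = 0 → P b = 0 := fun b hb => le_antisymm (hex b hb) (hP.1 b)
  refine ⟨hac, ?_⟩
  have h1 : HasSum (fun b => P b * Real.log (P b / Q b))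
      (∑ a, P (e a) * Real.log (P (e a) / Q (e a))) :=
    (he.hasSum_iff fun b hb => by simp [hsupp b hb]).1
      (hasSum_fintype fun a => P (e a) * Real.log (P (e a) / Q (e a)))
  have h2 := (h1.add hQ.2).sub hP.2
  rw [add_sub_cancel_right] at h2
  have hnn : ∀ b, 0 ≤ P b * Real.log (P b / Q b) + Q b - P b := by
    intro b
    rcases (hP.1 b).eq_or_lt with hb | hb
    · simpa [← hb] using hQ.1 b
    have hq : 0 < Q b := (hQ.1 b).lt_of_ne fun h => hb.ne' (hac b h.symm)
    have h := mul_le_mul_of_nonneg_left (Real.log_le_sub_one_of_pos (div_pos hq hb)) hb.le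
    rw [Real.log_div hq.ne' hb.ne', mul_sub, mul_sub, mul_div_cancel₀ _ hb.ne'] at h
    rw [Real.log_div hb.ne' hq.ne']
    linarith
  rw [← ENNReal.ofReal_tsum_of_nonneg hnn h2.summable, h2.tsum_eq,
    ← ENNReal.ofReal_div_of_pos hlog2, ENNReal.ofReal_le_ofReal_iff hs0, div_le_iff₀ hlog2] at hs
  exact hs

lemma IsPmf.extend {α β : Type*} [Fintype α] {e : α → β} (he : Function.Injective e) {r : α → ℝ}
    (hr0 : ∀ a, 0 ≤ r a) (hr : ∑ a, r a = 1) : IsPmf (Function.extend e r 0) := by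
  refine ⟨fun b => ?_, ?_⟩
  · by_cases hb : ∃ a, e a = b
    · obtain ⟨a, rfl⟩ := hb
      rw [he.extend_apply]
      exact hr0 a
    · rw [Function.extend_apply' _ _ _ hb]
      rfl
  · refine (he.hasSum_iff fun b hb => ?_).1 ?_
    · rw [Function.extend_apply' _ _ _ fun ⟨a, ha⟩ => hb ⟨a, ha⟩]
      rfl
    · rw [Function.extend_comp he, ← hr]
      exact hasSum_fintype r

lemma prodPmf_extend {α β : Type*} {e : α → β} (he : Function.Injective e) (r : α → ℝ) (n : ℕ) :
    prodPmf (Function.extend e r 0) n =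
      Function.extend (fun y : Fin n → α => e ∘ y) (fun y => ∏ t, r (y t)) 0 := by
  ext x
  by_cases hx : ∃ y : Fin n → α, e ∘ y = x
  · obtain ⟨y, rfl⟩ := hx
    rw [he.comp_left.extend_apply]
    simp [prodPmf, he.extend_apply]
  · rw [Function.extend_apply' _ _ _ hx]
    have : ∃ t, ¬ ∃ a, e a = x t := by
      by_contra! h
      choose y hy using h
      exact hx ⟨y, funext hy⟩
    obtain ⟨t, ht⟩ := this
    refine Finset.prod_eq_zero (Finset.mem_univ t) ?_
    rw [Function.extend_apply' _ _ _ ht]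
    rfl

/-- The letters `2 * i + 1` and `2 * i + 2` form the `i`-th pair. -/
def pairLetter (p : ℕ) (a : Fin p × Bool) : ℕ+ :=
  ⟨2 * a.1 + 1 + a.2.toNat, by omega⟩

lemma pairLetter_injective (p : ℕ) : Function.Injective (pairLetter p) := by
  rintro ⟨i, b⟩ ⟨j, d⟩ h
  have h' := congrArg PNat.val h
  simp only [pairLetter, PNat.mk_coe] at h'
  have hb := b.toNat_le
  have hd := d.toNat_le
  have hij : i = j := Fin.ext (by omega)
  subst hij
  have hbd : b.toNat = d.toNat := by omega
  cases b <;> cases d <;> simp_all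

lemma pairLetter_le (p : ℕ) (a : Fin p × Bool) : pairLetter p a ≤ 2 * pnat a.1 := by
  have hb := a.2.toNat_le
  rw [← PNat.coe_le_coe]
  change 2 * (a.1 : ℕ) + 1 + a.2.toNat ≤ 2 * ((a.1 : ℕ) + 1)
  omega

/-- Every bound in bits for the divergence from the envelope class to a law `Q` on words is at
least the sum of the redundancies of the pairs of letters. -/
lemma sum_le_of_forall_klDiv2_le {f : ℕ+ → ℝ} (hmono : Antitone f) {p n : ℕ} (hn : 0 < n)
    {w : Fin p → ℝ} (hw : ∀ i, 0 < w i) (hw1 : ∑ i, w i = 1)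
    (hwf : ∀ i : Fin p, w i ≤ f (2 * pnat i)) {lam : ℝ} (hlam0 : 0 < lam) (hlam1 : lam < 1)
    {Q : (Fin n → ℕ+) → ℝ} (hQ : IsPmf Q) {s : ℝ}
    (hs0 : 0 ≤ s) (hs : ∀ P ∈ envClass f, klDiv2 (prodPmf P n) Q ≤ ENNReal.ofReal s)
    (hf0 : ∀ k, 0 ≤ f k) :
    ∑ i, 1 / (1 + 1 / (lam ^ 2 * n * w i)) *
      max 0 (1 / 2 * Real.log (Real.pi * ((1 - lam) * n * w i) / 2) - 1 / 2) ≤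
      s * Real.log 2 := by
  have he := pairLetter_injective p
  have hew : Function.Injective fun y : Fin n → Fin p × Bool => pairLetter p ∘ y := he.comp_left
  have hw0 : ∀ i, 0 ≤ w i := fun i => (hw i).le
  have hbound : ∀ x, (∀ y, Q (pairLetter p ∘ y) = 0 → ∏ t, pairLaw w x (y t) = 0) ∧
      ∑ y : Fin n → Fin p × Bool, (∏ t, pairLaw w x (y t)) *
        Real.log ((∏ t, pairLaw w x (y t)) / Q (pairLetter p ∘ y)) ≤ s * Real.log 2 := by
    intro x
    have hmem : Function.extend (pairLetter p) (pairLaw w x) 0 ∈ envClass f := by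
      refine ⟨IsPmf.extend he (pairLaw_nonneg hw0 x) (sum_pairLaw hw1 x), fun k => ?_⟩
      by_cases hk : ∃ a, pairLetter p a = k
      · obtain ⟨a, rfl⟩ := hk
        rw [he.extend_apply]
        exact (pairLaw_le hw0 x a).trans ((hwf a.1).trans (hmono (pairLetter_le p a)))
      · rw [Function.extend_apply' _ _ _ hk]
        exact hf0 k
    have h := hs _ hmem
    rw [prodPmf_extend he] at h
    have h' := sum_log_le_of_klDiv2_le hew (IsPmf.extend hew
      (fun y => Finset.prod_nonneg fun t _ => pairLaw_nonneg hw0 x _)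
      (sum_word_prob n (sum_pairLaw hw1 x)))
      (fun b hb => by rw [Function.extend_apply' _ _ _ fun ⟨a, ha⟩ => hb ⟨a, ha⟩]; rfl) hQ hs0 h
    simp only [hew.extend_apply] at h'
    refine ⟨fun y hy => ?_, h'.2⟩
    have := h'.1 _ hy
    rwa [hew.extend_apply (fun y => ∏ t, pairLaw w x (y t))] at this
  refine sum_le_of_pairLaw_divergence_le hw hw1 hn hlam0 hlam1 (fun y => Q (pairLetter p ∘ y))
    (fun y => hQ.1 _) ?_ (fun x => (hbound x).1) (fun x => (hbound x).2)
  exact hasSum_le_inj _ hew (fun _ _ => hQ.1 _) (fun _ => le_rfl) (hasSum_fintype _) hQ.2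

end Envelope

/-- general lower bound on the minimax redundancy of an envelope class. -/
theorem stmt10 (f : ℕ+ → ℝ) (hf0 : ∀ k, 0 ≤ f k) (hf1 : ∀ k, f k ≤ 1)
    (hmono : Antitone f) (hsum : Summable f)
    (c : ℕ → ℝ)
    (hc : ∀ q : ℕ, c q = ∑ k ∈ Finset.range q, f (2 * pnat k))
    (hcinf : 1 < ∑' k : ℕ, f (2 * pnat k))
    (p : ℕ+) (hcp : 1 < c (p : ℕ)) (hf2p : 0 < f (2 * p))
    (n : ℕ+) (eps lam : ℝ) (heps : 0 < eps) (hlam0 : 0 < lam) (hlam1 : lam < 1)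
    (hn : c (p : ℕ) / f (2 * p) * (10 / (eps * (1 - lam))) < (n : ℝ)) :
    ENNReal.ofReal
        ((1 / (1 + c (p : ℕ) / (lam ^ 2 * (n : ℝ) * f (2 * p)))) *
          (1 - (4 / Real.pi) *
            Real.sqrt (5 * c (p : ℕ) / ((1 - lam) * eps * (n : ℝ) * f (2 * p)))) *
          ∑ i ∈ Finset.range (p : ℕ),
            (1 / 2 *
                Real.logb 2
                  ((n : ℝ) * (1 - lam) * Real.pi *
                      f (2 * pnat i) /
                    (2 * c (p : ℕ) * Real.exp 1)) -
              eps)) ≤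
      minimaxRedundancy (envClass f) (n : ℕ) := by
  have hc0 : 0 < c p := one_pos.trans hcp
  have hn0 : (0 : ℝ) < (n : ℕ) := by exact_mod_cast n.pos
  have hlam : 0 < 1 - lam := sub_pos.2 hlam1
  have hlog2 : 0 < Real.log 2 := Real.log_pos one_lt_two
  have hfge : ∀ i : Fin (p : ℕ), f (2 * p) ≤ f (2 * pnat i) := fun i => hmono (by
    have := i.2
    rw [← PNat.coe_le_coe]
    change 2 * ((i : ℕ) + 1) ≤ 2 * (p : ℕ)
    omega)
  have hfpos : ∀ i : Fin (p : ℕ), 0 < f (2 * pnat i) := fun i => hf2p.trans_le (hfge i)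
  have hcsum : ∑ i : Fin (p : ℕ), f (2 * pnat i) = c p := by
    rw [hc, Finset.sum_range]
  set w : Fin (p : ℕ) → ℝ := fun i => f (2 * pnat i) / c p with hw
  have hwpos : ∀ i, 0 < w i := fun i => div_pos (hfpos i) hc0
  have hw1 : ∑ i, w i = 1 := by
    rw [← Finset.sum_div, hcsum, div_self hc0.ne']
  have hwf : ∀ i : Fin (p : ℕ), w i ≤ f (2 * pnat i) := fun i => div_le_self (hfpos i).le hcp.le
  set A : ℝ := 1 / (1 + c p / (lam ^ 2 * (n : ℕ) * f (2 * p))) with hA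
  set B : ℝ := 1 - 4 / Real.pi * √(5 * c p / ((1 - lam) * eps * (n : ℕ) * f (2 * p))) with hB
  have hA0 : 0 ≤ A := by positivity
  have hB1 : B ≤ 1 := by
    have := Real.pi_pos
    have : 0 ≤ 4 / Real.pi * √(5 * c p / ((1 - lam) * eps * (n : ℕ) * f (2 * p))) := by positivity
    linarith
  have hB0 : 0 ≤ B := by
    have hfrac : 5 * c p / ((1 - lam) * eps * (n : ℕ) * f (2 * p)) ≤ (3 / 4) ^ 2 := by
      rw [div_mul_div_comm, div_lt_iff₀ (by positivity)] at hn
      rw [div_le_iff₀ (by positivity)]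
      nlinarith
    have hsqrt := Real.sqrt_le_sqrt hfrac
    rw [Real.sqrt_sq (by norm_num)] at hsqrt
    have hpi := Real.pi_gt_three
    have : 4 / Real.pi * √(5 * c p / ((1 - lam) * eps * (n : ℕ) * f (2 * p))) ≤ 1 := by
      rw [div_mul_eq_mul_div, div_le_one (by positivity)]
      linarith
    linarith
  refine le_iInf₂ fun Q hQ => ?_
  by_cases htop : (⨆ P ∈ envClass f, klDiv2 (prodPmf P n) Q) = ⊤
  · rw [htop]
    exact le_top
  rw [← ENNReal.ofReal_toReal htop]
  refine ENNReal.ofReal_le_ofReal ?_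
  have hmain := sum_le_of_forall_klDiv2_le hmono n.pos hwpos hw1 hwf hlam0 hlam1 hQ
    ENNReal.toReal_nonneg (fun P hP => by
      rw [ENNReal.ofReal_toReal htop]
      exact le_iSup₂ (f := fun P _ => klDiv2 (prodPmf P n) Q) P hP) hf0
  rw [← div_le_iff₀ hlog2, Finset.sum_div] at hmain
  refine le_trans ?_ hmain
  rw [Finset.sum_range, Finset.mul_sum]
  refine Finset.sum_le_sum fun i _ => ?_
  set L : ℝ := 1 / 2 * Real.logb 2
    ((n : ℕ) * (1 - lam) * Real.pi * f (2 * pnat i) / (2 * c p * Real.exp 1)) with hL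
  have hLeq : 1 / 2 * Real.log (Real.pi * ((1 - lam) * (n : ℕ) * w i) / 2) - 1 / 2 =
      L * Real.log 2 := by
    have hx : (n : ℕ) * (1 - lam) * Real.pi * f (2 * pnat i) / (2 * c p * Real.exp 1) =
        Real.pi * ((1 - lam) * (n : ℕ) * w i) / 2 / Real.exp 1 := by
      rw [hw]
      field_simp
    have hpos : 0 < Real.pi * ((1 - lam) * (n : ℕ) * w i) / 2 := by
      have := hwpos i
      have := Real.pi_pos
      positivity
    rw [hL, hx, Real.logb, Real.log_div hpos.ne' (Real.exp_ne_zero 1), Real.log_exp]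
    field_simp
  rw [hLeq, mul_div_assoc, ← zero_mul (Real.log 2), ← max_mul_of_nonneg _ _ hlog2.le,
    mul_div_cancel_right₀ _ hlog2.ne']
  have hAle : A ≤ 1 / (1 + 1 / (lam ^ 2 * (n : ℕ) * w i)) := by
    have hwi : 1 / (lam ^ 2 * (n : ℕ) * w i) = c p / (lam ^ 2 * (n : ℕ) * f (2 * pnat i)) := by
      have := (hfpos i).ne'
      rw [hw]
      field_simp
    rw [hA, hwi]
    have := hfge i
    have := hfpos i
    gcongr
  have hmax : 0 ≤ max 0 L := le_max_left _ _
  calc A * B * (L - eps) ≤ A * B * max 0 L :=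
        mul_le_mul_of_nonneg_left ((sub_le_self L heps.le).trans (le_max_right _ _))
          (mul_nonneg hA0 hB0)
    _ ≤ A * 1 * max 0 L := by gcongr
    _ = A * max 0 L := by rw [mul_one]
    _ ≤ _ := by gcongr
end
end

section
/- Let α > 1 and C > 0, and let Λ_{C·^{−α}} be the envelope class of the function f(x) = min(1, C/x^α). Then there exists a constant B (depending only on C and α) such that for all integers n ≥ 2, R*(Λ_{C·^{−α}}^n) ≤ (2Cn/(α−1))^{1/α}·(log n)^{1−1/α} + B. -/
open scoped ENNReal BigOperators

noncomputable section

/-- Majorant of `sup_{0 ≤ μ ≤ λ} e^{m-μ} (μ/m)^m`, as a function of `y = e λ` and `m`. -/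
def typeWeight (y : ℝ) (m : ℕ) : ℝ :=
  if m = 0 then 1 else if m = 1 then y else y ^ 2 / (m : ℝ) ^ 2

@[simp] lemma typeWeight_zero (y : ℝ) : typeWeight y 0 = 1 := by simp [typeWeight]

lemma typeWeight_pos {y : ℝ} (hy : 0 < y) (m : ℕ) : 0 < typeWeight y m := by
  unfold typeWeight
  split_ifs <;> positivity

lemma sum_typeWeight_le {y : ℝ} (hy : 0 < y) (n : ℕ) :
    ∑ m ∈ Finset.range (n + 1), typeWeight y m ≤ (1 + y) ^ 2 := by
  have key : ∀ n : ℕ, ∑ m ∈ Finset.range (n + 2), typeWeight y m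
      ≤ 1 + y + y ^ 2 * (1 - 1 / ((n : ℝ) + 1)) := by
    intro n
    induction n with
    | zero => simp [Finset.sum_range_succ, typeWeight]
    | succ n ih =>
      rw [Finset.sum_range_succ]
      have h1 : typeWeight y (n + 2) = y ^ 2 * (1 / ((n : ℝ) + 2) ^ 2) := by
        simp [typeWeight, div_eq_mul_inv]
      have h2 : 1 / ((n : ℝ) + 2) ^ 2 ≤ 1 / ((n : ℝ) + 1) - 1 / ((n : ℝ) + 2) := by
        rw [div_sub_div _ _ (by positivity) (by positivity),
          div_le_div_iff₀ (by positivity) (by positivity)]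
        nlinarith [(Nat.cast_nonneg n : (0 : ℝ) ≤ n)]
      have h3 := mul_le_mul_of_nonneg_left h2 (sq_nonneg y)
      have h4 : (((n + 1 : ℕ) : ℝ) + 1) = (n : ℝ) + 2 := by push_cast; ring
      rw [h1, h4]
      linarith
  have hmono : ∑ m ∈ Finset.range (n + 1), typeWeight y m
      ≤ ∑ m ∈ Finset.range (n + 2), typeWeight y m := by
    rw [Finset.sum_range_succ _ (n + 1)]
    linarith [typeWeight_pos hy (n + 1)]
  have h5 : (0 : ℝ) ≤ 1 / ((n : ℝ) + 1) := by positivity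
  nlinarith [key n, mul_nonneg (sq_nonneg y) h5]

lemma pow_le_typeWeight {N lam p : ℝ} (hN : 0 < N) (hp : 0 ≤ p) (hlam : N * p ≤ lam) (m : ℕ) :
    p ^ m ≤ (m / N) ^ m * Real.exp (N * p - m) * typeWeight (Real.exp 1 * lam) m := by
  rcases Nat.eq_zero_or_pos m with rfl | hm
  · simpa using mul_nonneg hN.le hp
  have hm' : (0 : ℝ) < m := by exact_mod_cast hm
  set t : ℝ := N * p / m with ht
  have ht0 : 0 ≤ t := by positivity
  have hE1 : t * Real.exp (1 - t) ≤ 1 := by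
    have h : t ≤ Real.exp (t - 1) := by linarith [Real.add_one_le_exp (t - 1)]
    calc t * Real.exp (1 - t) ≤ Real.exp (t - 1) * Real.exp (1 - t) := by gcongr
      _ = 1 := by rw [← Real.exp_add]; simp
  have hE2 : t * Real.exp (1 - t) ≤ Real.exp 1 * lam / m := by
    calc t * Real.exp (1 - t) ≤ t * Real.exp 1 := by gcongr; linarith
      _ = Real.exp 1 * (N * p) / m := by rw [ht]; ring
      _ ≤ Real.exp 1 * lam / m := by gcongr
  have hE0 : 0 ≤ t * Real.exp (1 - t) := by positivity
  have hw : (t * Real.exp (1 - t)) ^ m ≤ typeWeight (Real.exp 1 * lam) m := by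
    rcases Nat.lt_or_ge m 2 with h2 | h2
    · obtain rfl : m = 1 := by omega
      simpa [typeWeight] using hE2
    · calc (t * Real.exp (1 - t)) ^ m ≤ (t * Real.exp (1 - t)) ^ 2 :=
            pow_le_pow_of_le_one hE0 hE1 h2
        _ ≤ (Real.exp 1 * lam / m) ^ 2 := by gcongr
        _ = typeWeight (Real.exp 1 * lam) m := by
            rw [typeWeight, if_neg (by omega), if_neg (by omega), div_pow]
  have hexp : Real.exp (1 - t) ^ m = Real.exp (m - N * p) := by
    rw [← Real.exp_nat_mul]
    congr 1
    rw [ht]; field_simp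
  calc p ^ m = (m / N) ^ m * (Real.exp (N * p - m) * Real.exp (m - N * p)) * t ^ m := by
        rw [← Real.exp_add, sub_add_sub_cancel, sub_self, Real.exp_zero, mul_one, ← mul_pow, ht]
        congr 1
        field_simp
    _ = (m / N) ^ m * Real.exp (N * p - m) * (t * Real.exp (1 - t)) ^ m := by
        rw [mul_pow, hexp]; ring
    _ ≤ _ := by gcongr

/-- The number of occurrences of `k` in the word `x`. -/
def wordCount {α : Type*} [DecidableEq α] {n : ℕ} (x : Fin n → α) (k : α) : ℕ :=
  (Finset.univ.filter fun i => x i = k).card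

lemma wordCount_le {α : Type*} [DecidableEq α] {n : ℕ} (x : Fin n → α) (k : α) :
    wordCount x k ≤ n := by
  simpa [wordCount] using Finset.card_filter_le Finset.univ fun i => x i = k

lemma prod_word_eq {α : Type*} [DecidableEq α] {n : ℕ} (x : Fin n → α) {s : Finset α}
    (hx : ∀ i, x i ∈ s) (g : α → ℝ) : ∏ i, g (x i) = ∏ k ∈ s, g k ^ wordCount x k := by
  rw [Finset.prod_comp g x]
  refine Finset.prod_subset (fun k hk => ?_) (fun k _ hk => ?_)
  · obtain ⟨i, -, rfl⟩ := Finset.mem_image.1 hk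
    exact hx i
  · have : Finset.univ.filter (fun i => x i = k) = ∅ := by
      ext i
      simp only [Finset.mem_filter, Finset.mem_univ, true_and, Finset.notMem_empty, iff_false]
      rintro rfl
      exact hk (Finset.mem_image_of_mem _ (Finset.mem_univ i))
    simp [this]

lemma sum_wordCount {α : Type*} [DecidableEq α] {n : ℕ} (x : Fin n → α) {s : Finset α}
    (hx : ∀ i, x i ∈ s) : ∑ k ∈ s, wordCount x k = n := by
  have := Finset.card_eq_sum_card_fiberwise (s := Finset.univ) (f := x) (t := s)
    (fun i _ => hx i)
  simpa [wordCount] using this.symm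

/-- Majorant of the maximum likelihood of a word over the envelope class, where `y k` stands
for `e n f(k)`. -/
def likelihoodMajorant {α : Type*} [DecidableEq α] (y : α → ℝ) {n : ℕ} (x : Fin n → α) : ℝ :=
  (∏ i, (wordCount x (x i) : ℝ) / n) *
    ∏ k ∈ Finset.univ.image x, typeWeight (y k) (wordCount x k)

lemma likelihoodMajorant_eq {α : Type*} [DecidableEq α] (y : α → ℝ) {n : ℕ} (x : Fin n → α)
    {s : Finset α} (hx : ∀ i, x i ∈ s) :
    likelihoodMajorant y x =
      (∏ i, (wordCount x (x i) : ℝ) / n) * ∏ k ∈ s, typeWeight (y k) (wordCount x k) := by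
  unfold likelihoodMajorant
  congr 1
  refine Finset.prod_subset (fun k hk => ?_) (fun k _ hk => ?_)
  · obtain ⟨i, -, rfl⟩ := Finset.mem_image.1 hk
    exact hx i
  · have : wordCount x k = 0 := by
      simp only [wordCount, Finset.card_eq_zero]
      ext i
      simp only [Finset.mem_filter, Finset.mem_univ, true_and, Finset.notMem_empty, iff_false]
      rintro rfl
      exact hk (Finset.mem_image_of_mem _ (Finset.mem_univ i))
    simp [this]

lemma likelihoodMajorant_pos {α : Type*} [DecidableEq α] {y : α → ℝ} (hy : ∀ k, 0 < y k)
    {n : ℕ} (x : Fin n → α) : 0 < likelihoodMajorant y x := by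
  refine mul_pos (Finset.prod_pos fun i _ => ?_)
    (Finset.prod_pos fun k _ => typeWeight_pos (hy k) _)
  have h1 : 0 < wordCount x (x i) := Finset.card_pos.2 ⟨i, by simp⟩
  have h2 : 0 < n := i.pos
  positivity

lemma prodPmf_le_likelihoodMajorant {α : Type*} [DecidableEq α] {P lam : α → ℝ} (hP : IsPmf P)
    {n : ℕ} (hn : 0 < n) (hlam : ∀ k, n * P k ≤ lam k) (x : Fin n → α) :
    prodPmf P n x ≤ likelihoodMajorant (fun k => Real.exp 1 * lam k) x := by
  have hx : ∀ i, x i ∈ Finset.univ.image x := fun i => Finset.mem_image_of_mem _ (Finset.mem_univ i)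
  set s := Finset.univ.image x
  have hn' : (0 : ℝ) < n := by exact_mod_cast hn
  have hlam0 : ∀ k, 0 ≤ lam k := fun k => (mul_nonneg hn'.le (hP.1 k)).trans (hlam k)
  have hw : ∀ k m, 0 ≤ typeWeight (Real.exp 1 * lam k) m := by
    intro k m
    have := hlam0 k
    unfold typeWeight
    split_ifs <;> positivity
  have hexp : ∏ k ∈ s, Real.exp (n * P k - wordCount x k) ≤ 1 := by
    rw [← Real.exp_sum, Real.exp_le_one_iff, Finset.sum_sub_distrib, ← Finset.mul_sum,
      ← Nat.cast_sum, sum_wordCount x hx]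
    have := sum_le_hasSum s (fun k _ => hP.1 k) hP.2
    nlinarith
  rw [likelihoodMajorant_eq _ x hx, prodPmf, prod_word_eq x hx P,
    prod_word_eq x hx fun k => (wordCount x k : ℝ) / n]
  calc ∏ k ∈ s, P k ^ wordCount x k
      ≤ ∏ k ∈ s, ((wordCount x k / n : ℝ) ^ wordCount x k * Real.exp (n * P k - wordCount x k) *
          typeWeight (Real.exp 1 * lam k) (wordCount x k)) :=
        Finset.prod_le_prod (fun k _ => pow_nonneg (hP.1 k) _)
          fun k _ => pow_le_typeWeight hn' (hP.1 k) (hlam k) _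
    _ = (∏ k ∈ s, (wordCount x k / n : ℝ) ^ wordCount x k) *
          (∏ k ∈ s, Real.exp (n * P k - wordCount x k)) *
          ∏ k ∈ s, typeWeight (Real.exp 1 * lam k) (wordCount x k) := by
        rw [Finset.prod_mul_distrib, Finset.prod_mul_distrib]
    _ ≤ _ := by
        refine mul_le_mul_of_nonneg_right ?_ (Finset.prod_nonneg fun k _ => hw k _)
        exact mul_le_of_le_one_right (Finset.prod_nonneg fun k _ => by positivity) hexp

lemma sum_likelihoodMajorant_le {α : Type*} [DecidableEq α] {y : α → ℝ} (hy : ∀ k, 0 < y k)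
    {n : ℕ} (hn : 0 < n) (s : Finset α) :
    ∑ x ∈ Fintype.piFinset (fun _ : Fin n => s), likelihoodMajorant y x ≤
      ∏ k ∈ s, (1 + y k) ^ 2 := by
  classical
  have hn' : (0 : ℝ) < n := by exact_mod_cast hn
  let ext : (s → ℕ) → α → ℕ := fun τ k => if h : k ∈ s then τ ⟨k, h⟩ else 0
  let U : Finset (s → ℕ) :=
    (Fintype.piFinset fun _ : s => Finset.range (n + 1)).filter fun τ => ∑ k, τ k = n
  let W : (s → ℕ) → ℝ := fun τ => ∏ k : s, typeWeight (y k) (τ k)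
  have hW : ∀ τ, 0 ≤ W τ := fun τ => Finset.prod_nonneg fun k _ => (typeWeight_pos (hy k) _).le
  calc ∑ x ∈ Fintype.piFinset (fun _ : Fin n => s), likelihoodMajorant y x
      ≤ ∑ x ∈ Fintype.piFinset (fun _ : Fin n => s),
          ∑ τ ∈ U, (∏ i, (ext τ (x i) : ℝ) / n) * W τ := by
        refine Finset.sum_le_sum fun x hx => ?_
        have hx' : ∀ i, x i ∈ s := by simpa using hx
        have hmem : (fun k : s => wordCount x k) ∈ U := by
          simp only [U, Finset.mem_filter, Fintype.mem_piFinset, Finset.mem_range]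
          refine ⟨fun k => Nat.lt_succ_of_le (wordCount_le x k), ?_⟩
          rw [Finset.sum_coe_sort s (wordCount x), sum_wordCount x hx']
        refine le_trans (le_of_eq ?_) (Finset.single_le_sum
          (f := fun τ => (∏ i, (ext τ (x i) : ℝ) / n) * W τ) (fun τ _ => ?_) hmem)
        · rw [likelihoodMajorant_eq y x hx']
          simp only [W, ext, hx', dite_true]
          rw [Finset.prod_coe_sort s fun k => typeWeight (y k) (wordCount x k)]
        · exact mul_nonneg (Finset.prod_nonneg fun i _ => by positivity) (hW τ)
    _ = ∑ τ ∈ U, W τ := by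
        rw [Finset.sum_comm]
        refine Finset.sum_congr rfl fun τ hτ => ?_
        have hτ' : ∑ k, τ k = n := (Finset.mem_filter.1 hτ).2
        have hsum : ∑ k ∈ s, (ext τ k : ℝ) / n = 1 := by
          rw [← Finset.sum_div, ← Nat.cast_sum, ← Finset.sum_coe_sort s (ext τ)]
          simp only [ext, Finset.coe_mem, dite_true, Subtype.coe_eta, hτ']
          exact div_self hn'.ne'
        rw [← Finset.sum_mul,
          ← Finset.prod_univ_sum (fun _ : Fin n => s) fun _ k => (ext τ k : ℝ) / n]
        simp [hsum]
    _ ≤ ∑ τ ∈ Fintype.piFinset fun _ : s => Finset.range (n + 1), W τ :=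
        Finset.sum_le_sum_of_subset_of_nonneg (Finset.filter_subset _ _) fun τ _ _ => hW τ
    _ = ∏ k : s, ∑ m ∈ Finset.range (n + 1), typeWeight (y k) m :=
        (Finset.prod_univ_sum _ _).symm
    _ ≤ ∏ k : s, (1 + y k) ^ 2 :=
        Finset.prod_le_prod (fun k _ => Finset.sum_nonneg fun m _ => (typeWeight_pos (hy k) m).le)
          fun k _ => sum_typeWeight_le (hy k) n
    _ = ∏ k ∈ s, (1 + y k) ^ 2 := Finset.prod_coe_sort s fun k => (1 + y k) ^ 2

/-- Shtarkov-type upper bound: a positive majorant `S` of the maximum likelihood whose finite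
partial sums are bounded by `M` gives minimax regret at most `log M`. -/
lemma minimaxRegret_le_of_majorant {α : Type*} [Nonempty α] {Λ : Set (α → ℝ)} {n : ℕ}
    {S : (Fin n → α) → ℝ} {M : ℝ} (hS : ∀ x, 0 < S x)
    (hPS : ∀ P ∈ Λ, ∀ x, prodPmf P n x ≤ S x) (hM : ∀ T : Finset (Fin n → α), ∑ x ∈ T, S x ≤ M) :
    minimaxRegret Λ n ≤ ENNReal.ofReal (Real.logb 2 M) := by
  have hsum : Summable S := summable_of_sum_le (fun x => (hS x).le) hM
  set Z := ∑' x, S x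
  have hZM : Z ≤ M := hsum.tsum_le_of_sum_le hM
  have hZ : 0 < Z := hsum.tsum_pos (fun x => (hS x).le) (fun _ => Classical.arbitrary α) (hS _)
  refine iInf₂_le_of_le (fun x => S x / Z) ⟨fun x => (div_pos (hS x) hZ).le, ?_⟩ ?_
  · exact div_self hZ.ne' ▸ hsum.hasSum.div_const Z
  refine iSup_le fun x => iSup₂_le fun P hP => ?_
  unfold regretTerm
  split_ifs with h1 h2
  · exact zero_le
  · exact absurd h2 (not_le.2 (div_pos (hS x) hZ))
  · push Not at h1
    have hSx := hS x
    refine ENNReal.ofReal_le_ofReal (Real.logb_le_logb_of_le one_lt_two (by positivity) ?_)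
    rw [div_div_eq_mul_div, div_le_iff₀ hSx]
    calc prodPmf P n x * Z ≤ S x * M := mul_le_mul (hPS P hP x) hZM hZ.le hSx.le
      _ = M * S x := mul_comm _ _

lemma rpow_neg_le_telescope {a x : ℝ} (ha : 1 < a) (hx : 0 < x) :
    (x + 1) ^ (-a) ≤ (x ^ (1 - a) - (x + 1) ^ (1 - a)) / (a - 1) := by
  have hx1 : 0 < x + 1 := by linarith
  rw [le_div_iff₀ (by linarith)]
  have h1 : Real.log (x / (x + 1)) ≤ -1 / (x + 1) := by
    refine (Real.log_le_sub_one_of_pos (by positivity)).trans (le_of_eq ?_)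
    field_simp
    ring
  have h2 : 1 + (a - 1) / (x + 1) ≤ (x / (x + 1)) ^ (1 - a) := by
    rw [Real.rpow_def_of_pos (by positivity)]
    have h3 : (a - 1) / (x + 1) ≤ Real.log (x / (x + 1)) * (1 - a) := by
      have := mul_le_mul_of_nonneg_right h1 (show (0 : ℝ) ≤ a - 1 by linarith)
      have e : -1 / (x + 1) * (a - 1) = -((a - 1) / (x + 1)) := by ring
      linarith
    linarith [Real.add_one_le_exp (Real.log (x / (x + 1)) * (1 - a))]
  rw [Real.div_rpow hx.le hx1.le, le_div_iff₀ (by positivity)] at h2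
  have h4 : (x + 1) ^ (-a) = (x + 1) ^ (1 - a) / (x + 1) := by
    rw [show -a = (1 - a) - 1 by ring, Real.rpow_sub_one hx1.ne']
  rw [h4]
  have e : (1 + (a - 1) / (x + 1)) * (x + 1) ^ (1 - a)
      = (x + 1) ^ (1 - a) + (x + 1) ^ (1 - a) / (x + 1) * (a - 1) := by ring
  linarith

lemma sum_rpow_neg_tail_le {a : ℝ} (ha : 1 < a) {N : ℕ} (hN : 0 < N) (M : ℕ) :
    ∑ j ∈ Finset.range M, ((N : ℝ) + j + 1) ^ (-a) ≤ (N : ℝ) ^ (1 - a) / (a - 1) := by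
  have hN' : (0 : ℝ) < N := by exact_mod_cast hN
  have ha' : 0 < a - 1 := by linarith
  have key : ∑ j ∈ Finset.range M, ((N : ℝ) + j + 1) ^ (-a)
      ≤ ((N : ℝ) ^ (1 - a) - ((N : ℝ) + M) ^ (1 - a)) / (a - 1) := by
    induction M with
    | zero => simp
    | succ M ih =>
      rw [Finset.sum_range_succ]
      have h := rpow_neg_le_telescope ha (show (0 : ℝ) < N + M by positivity)
      refine (add_le_add ih h).trans (le_of_eq ?_)
      push_cast
      rw [← add_div, ← add_assoc]
      ring
  refine key.trans ?_
  gcongr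
  have : 0 ≤ ((N : ℝ) + M) ^ (1 - a) := by positivity
  linarith

lemma prod_one_add_rpow_head_le {a : ℝ} (ha : 1 < a) (N : ℕ) :
    ∏ j ∈ Finset.range N, (1 + (N : ℝ) ^ a / ((j : ℝ) + 1) ^ a) ≤ Real.exp (2 * N * a) := by
  have ha0 : 0 < a := by linarith
  have hfac : ∏ j ∈ Finset.range N, ((j : ℝ) + 1) = N.factorial := by
    rw [← Finset.prod_range_add_one_eq_factorial]
    push_cast
    rfl
  calc ∏ j ∈ Finset.range N, (1 + (N : ℝ) ^ a / ((j : ℝ) + 1) ^ a)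
      ≤ ∏ j ∈ Finset.range N, (2 * N / ((j : ℝ) + 1)) ^ a := by
        refine Finset.prod_le_prod (fun j _ => by positivity) fun j hj => ?_
        have hj' : (j : ℝ) + 1 ≤ N := by exact_mod_cast Finset.mem_range.1 hj
        have h1 : (1 : ℝ) ≤ (N / ((j : ℝ) + 1)) ^ a :=
          Real.one_le_rpow ((one_le_div (by positivity)).2 hj') ha0.le
        have h2 : (2 : ℝ) ≤ 2 ^ a := by
          simpa using Real.rpow_le_rpow_of_exponent_le one_le_two ha.le
        rw [mul_div_assoc, Real.mul_rpow (by positivity) (by positivity),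
          ← Real.div_rpow (by positivity) (by positivity)]
        nlinarith
    _ = ((2 * N) ^ N / N.factorial : ℝ) ^ a := by
        rw [Real.finsetProd_rpow _ _ (fun j _ => by positivity), Finset.prod_div_distrib, hfac]
        simp
    _ ≤ (Real.exp (2 * N)) ^ a := by
        gcongr
        exact Real.pow_div_factorial_le_exp _ (by positivity) _
    _ = Real.exp (2 * N * a) := by rw [← Real.exp_mul]

lemma prod_one_add_rpow_le {a : ℝ} (ha : 1 < a) {N : ℕ} (hN : 0 < N) (s : Finset ℕ+) :
    ∏ k ∈ s, (1 + (N : ℝ) ^ a / (k : ℝ) ^ a) ≤ Real.exp (N * (2 * a + 1 / (a - 1))) := by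
  have hN' : (0 : ℝ) < N := by exact_mod_cast hN
  obtain ⟨M, hM⟩ : ∃ M, s.image PNat.natPred ⊆ Finset.range M :=
    Finset.exists_nat_subset_range _
  have hcast : ∀ k : ℕ+, (k : ℝ) = (k.natPred : ℝ) + 1 := fun k => by
    exact_mod_cast (PNat.natPred_add_one k).symm
  calc ∏ k ∈ s, (1 + (N : ℝ) ^ a / (k : ℝ) ^ a)
      = ∏ j ∈ s.image PNat.natPred, (1 + (N : ℝ) ^ a / ((j : ℝ) + 1) ^ a) := by
        rw [Finset.prod_image fun _ _ _ _ h => PNat.natPred_injective h]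
        exact Finset.prod_congr rfl fun k _ => by rw [hcast]
    _ ≤ ∏ j ∈ Finset.range (N + M), (1 + (N : ℝ) ^ a / ((j : ℝ) + 1) ^ a) := by
        refine Finset.prod_le_prod_of_subset_of_one_le
          (hM.trans (Finset.range_mono (Nat.le_add_left _ _))) (fun j _ => by positivity)
          fun j _ _ => ?_
        have : (0 : ℝ) ≤ (N : ℝ) ^ a / ((j : ℝ) + 1) ^ a := by positivity
        linarith
    _ = (∏ j ∈ Finset.range N, (1 + (N : ℝ) ^ a / ((j : ℝ) + 1) ^ a)) *
          ∏ j ∈ Finset.range M, (1 + (N : ℝ) ^ a / ((N : ℝ) + j + 1) ^ a) := by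
        rw [Finset.prod_range_add]
        push_cast
        rfl
    _ ≤ Real.exp (2 * N * a) * Real.exp (N / (a - 1)) := by
        refine mul_le_mul (prod_one_add_rpow_head_le ha N) ?_
          (Finset.prod_nonneg fun j _ => by positivity) (Real.exp_pos _).le
        calc ∏ j ∈ Finset.range M, (1 + (N : ℝ) ^ a / ((N : ℝ) + j + 1) ^ a)
            ≤ ∏ j ∈ Finset.range M, Real.exp ((N : ℝ) ^ a * ((N : ℝ) + j + 1) ^ (-a)) := by
              refine Finset.prod_le_prod (fun j _ => by positivity) fun j _ => ?_
              rw [Real.rpow_neg (by positivity), ← div_eq_mul_inv, add_comm]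
              exact Real.add_one_le_exp _
          _ = Real.exp ((N : ℝ) ^ a * ∑ j ∈ Finset.range M, ((N : ℝ) + j + 1) ^ (-a)) := by
              rw [← Real.exp_sum, Finset.mul_sum]
          _ ≤ Real.exp ((N : ℝ) ^ a * ((N : ℝ) ^ (1 - a) / (a - 1))) := by
              gcongr
              exact sum_rpow_neg_tail_le ha hN M
          _ = Real.exp (N / (a - 1)) := by
              rw [← mul_div_assoc, ← Real.rpow_add hN']
              simp
    _ = Real.exp (N * (2 * a + 1 / (a - 1))) := by
        rw [← Real.exp_add]
        ring_nf

/-- The minimax regret of the power-law envelope class is `O(n^{1/α})`. -/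
lemma minimaxRegret_powerLaw_le {alpha C : ℝ} (halpha : 1 < alpha) (hC : 0 < C) :
    ∃ K : ℝ, 0 ≤ K ∧ ∀ n : ℕ, 0 < n →
      minimaxRegret (envClass fun k : ℕ+ => min 1 (C / (k : ℝ) ^ alpha)) n ≤
        ENNReal.ofReal (K * ((n : ℝ) ^ (1 / alpha) + 1)) := by
  have ha0 : 0 < alpha := by linarith
  have ha1 : 0 < alpha - 1 := by linarith
  set c : ℝ := 2 * alpha + 1 / (alpha - 1) with hc
  have hc0 : 0 < c := by positivity
  set b : ℝ := (Real.exp 1 * C) ^ (1 / alpha) with hb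
  have hb0 : 0 < b := by positivity
  have hlog2 : 0 < Real.log 2 := Real.log_pos one_lt_two
  refine ⟨2 * c / Real.log 2 * (b + 1), by positivity, fun n hn => ?_⟩
  have hn' : (0 : ℝ) < n := by exact_mod_cast hn
  set N : ℕ := ⌈b * (n : ℝ) ^ (1 / alpha)⌉₊ with hNdef
  have hN : 0 < N := Nat.ceil_pos.2 (by positivity)
  have hNge : b * (n : ℝ) ^ (1 / alpha) ≤ N := Nat.le_ceil _
  have hNle : (N : ℝ) ≤ b * (n : ℝ) ^ (1 / alpha) + 1 := (Nat.ceil_lt_add_one (by positivity)).le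
  have hNpow : Real.exp 1 * (n * C) ≤ (N : ℝ) ^ alpha := by
    calc Real.exp 1 * (n * C) = (b * (n : ℝ) ^ (1 / alpha)) ^ alpha := by
          rw [hb, ← Real.mul_rpow (by positivity) (by positivity),
            ← Real.rpow_mul (by positivity), one_div_mul_cancel ha0.ne', Real.rpow_one]
          ring
      _ ≤ (N : ℝ) ^ alpha := by gcongr
  let lam : ℕ+ → ℝ := fun k => n * (C / (k : ℝ) ^ alpha)
  have hk : ∀ k : ℕ+, (0 : ℝ) < k := fun k => by exact_mod_cast k.pos
  have hy : ∀ k, 0 < Real.exp 1 * lam k := fun k => by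
    have := hk k
    positivity
  have hprod : ∀ s : Finset ℕ+, ∏ k ∈ s, (1 + Real.exp 1 * lam k) ^ 2 ≤ Real.exp (2 * (N * c)) := by
    intro s
    rw [Finset.prod_pow, two_mul, Real.exp_add, ← sq]
    refine pow_le_pow_left₀ (Finset.prod_nonneg fun k _ => by linarith [hy k]) ?_ 2
    refine (Finset.prod_le_prod (fun k _ => by linarith [hy k]) fun k _ => ?_).trans
      (prod_one_add_rpow_le halpha hN s)
    have := hk k
    calc 1 + Real.exp 1 * lam k = 1 + Real.exp 1 * (n * C) / (k : ℝ) ^ alpha := by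
          simp only [lam]; ring
      _ ≤ 1 + (N : ℝ) ^ alpha / (k : ℝ) ^ alpha := by gcongr
  have hmain := minimaxRegret_le_of_majorant
    (Λ := envClass fun k : ℕ+ => min 1 (C / (k : ℝ) ^ alpha)) (n := n)
    (S := likelihoodMajorant fun k => Real.exp 1 * lam k) (M := Real.exp (2 * (N * c)))
    (likelihoodMajorant_pos hy)
    (fun P hP x => prodPmf_le_likelihoodMajorant hP.1 hn
      (fun k => mul_le_mul_of_nonneg_left ((hP.2 k).trans (min_le_right _ _)) hn'.le) x)
    (fun T => by
      classical
      let s : Finset ℕ+ := T.biUnion fun x => Finset.univ.image x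
      refine le_trans (Finset.sum_le_sum_of_subset_of_nonneg (fun x hx => ?_)
        fun x _ _ => (likelihoodMajorant_pos hy x).le)
        ((sum_likelihoodMajorant_le hy hn s).trans (hprod s))
      rw [Fintype.mem_piFinset]
      exact fun i => Finset.mem_biUnion.2 ⟨x, hx, Finset.mem_image_of_mem _ (Finset.mem_univ i)⟩)
  refine hmain.trans (ENNReal.ofReal_le_ofReal ?_)
  rw [Real.logb, Real.log_exp]
  calc 2 * (N * c) / Real.log 2 = 2 * c / Real.log 2 * N := by ring
    _ ≤ 2 * c / Real.log 2 * ((b + 1) * ((n : ℝ) ^ (1 / alpha) + 1)) := by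
        gcongr
        have : 0 < (n : ℝ) ^ (1 / alpha) := by positivity
        nlinarith
    _ = _ := by ring

/-- upper bound on the minimax regret of power-law envelope classes. -/
theorem stmt12 (alpha C : ℝ) (halpha : 1 < alpha) (hC : 0 < C) :
    ∃ B : ℝ, ∀ n : ℕ, 2 ≤ n →
      minimaxRegret (envClass fun k : ℕ+ => min 1 (C / (k : ℝ) ^ alpha)) n ≤
        ENNReal.ofReal
          ((2 * C * (n : ℝ) / (alpha - 1)) ^ (1 / alpha) *
              Real.logb 2 (n : ℝ) ^ (1 - 1 / alpha) + B) := by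
  obtain ⟨K, hK0, hK⟩ := minimaxRegret_powerLaw_le halpha hC
  have ha0 : 0 < alpha := by linarith
  have ha1 : 0 < alpha - 1 := by linarith
  set c : ℝ := (2 * C / (alpha - 1)) ^ (1 / alpha) with hc
  have hc0 : 0 < c := by positivity
  have hexp : 0 < 1 - 1 / alpha := by
    rw [sub_pos, div_lt_one ha0]
    exact halpha
  have htend : Filter.Tendsto (fun n : ℕ => c * Real.logb 2 (n : ℝ) ^ (1 - 1 / alpha))
      Filter.atTop Filter.atTop :=
    ((tendsto_rpow_atTop hexp).comp ((Real.tendsto_logb_atTop one_lt_two).comp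
      tendsto_natCast_atTop_atTop)).const_mul_atTop hc0
  obtain ⟨N, hN⟩ := Filter.eventually_atTop.1 (htend.eventually_ge_atTop K)
  refine ⟨K * ((N : ℝ) ^ (1 / alpha) + 1), fun n hn => ?_⟩
  refine (hK n (by omega)).trans (ENNReal.ofReal_le_ofReal ?_)
  have hL : 0 ≤ Real.logb 2 (n : ℝ) :=
    Real.logb_nonneg one_lt_two (by exact_mod_cast (by omega : 1 ≤ n))
  have hsplit : (2 * C * (n : ℝ) / (alpha - 1)) ^ (1 / alpha) = c * (n : ℝ) ^ (1 / alpha) := by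
    rw [hc, ← Real.mul_rpow (by positivity) (by positivity)]
    congr 1
    ring
  rw [hsplit]
  have hNp : 0 ≤ K * (N : ℝ) ^ (1 / alpha) := by positivity
  rcases le_total N n with h | h
  · have h1 := mul_le_mul_of_nonneg_right (hN n h)
      (show (0 : ℝ) ≤ (n : ℝ) ^ (1 / alpha) by positivity)
    linarith
  · have h1 : K * (n : ℝ) ^ (1 / alpha) ≤ K * (N : ℝ) ^ (1 / alpha) := by gcongr
    have h2 : 0 ≤ c * (n : ℝ) ^ (1 / alpha) * Real.logb 2 (n : ℝ) ^ (1 - 1 / alpha) := by positivity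
    linarith
end
end

section
/- Let α > 0 and C > e^{2α}, and let Λ_{Ce^{−α·}} be the envelope class of the function f(x) = min(1, C·e^{−αx}). Then liminf_{n→∞} R+(Λ_{Ce^{−α·}}^n) / (log n)² ≥ 1/(8α). -/
open scoped ENNReal BigOperators

noncomputable section

open MeasureTheory ProbabilityTheory

lemma le_klDiv2_of_indicator {α : Type*} {P Q : α → ℝ} (hP : ∀ a, 0 ≤ P a) (hQ : ∀ a, 0 ≤ Q a)
    (A : Set α) {M δ : ℝ} (hM : 1 ≤ M)
    (hPA : ENNReal.ofReal δ ≤ ∑' a, A.indicator (fun a => ENNReal.ofReal (P a)) a)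
    (hQA : ∑' a, A.indicator (fun a => ENNReal.ofReal (Q a)) a ≤ ENNReal.ofReal (1 / M)) :
    ENNReal.ofReal ((δ * Real.log M - 1) / Real.log 2) ≤ klDiv2 P Q := by
  classical
  unfold klDiv2
  split_ifs with h
  · exact le_top
  push Not at h
  have hMpos : 0 < M := by linarith
  rw [ENNReal.ofReal_div_of_pos (Real.log_pos one_lt_two)]
  refine ENNReal.div_le_div_right ?_ _
  rw [ENNReal.ofReal_sub _ zero_le_one, tsub_le_iff_right, ENNReal.ofReal_one]
  calc ENNReal.ofReal (δ * Real.log M)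
      = ENNReal.ofReal δ * ENNReal.ofReal (Real.log M) :=
        ENNReal.ofReal_mul' (Real.log_nonneg hM)
    _ ≤ (∑' a, A.indicator (fun a => ENNReal.ofReal (P a)) a) * ENNReal.ofReal (Real.log M) := by
        gcongr
    _ ≤ ∑' a, (ENNReal.ofReal (P a * Real.log (P a / Q a) + Q a - P a) +
          A.indicator (fun a => ENNReal.ofReal (Q a)) a * ENNReal.ofReal M) := by
        rw [← ENNReal.tsum_mul_right]
        refine ENNReal.tsum_le_tsum fun a => ?_
        by_cases ha : a ∈ A
        · simp only [Set.indicator_of_mem ha]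
          rw [← ENNReal.ofReal_mul (hP a), ← ENNReal.ofReal_mul (hQ a)]
          refine le_trans (ENNReal.ofReal_le_ofReal ?_) ENNReal.ofReal_add_le
          rcases (hP a).eq_or_lt with h0 | h0
          · rw [← h0]
            have := mul_nonneg (hQ a) hMpos.le
            have := hQ a
            simp; linarith
          · have hq : 0 < Q a := by
              refine (hQ a).lt_of_ne fun hq => ?_
              exact absurd (h a hq.symm) (not_le.2 h0)
            have key := Real.log_le_sub_one_of_pos (div_pos (mul_pos hq hMpos) h0)
            rw [Real.log_div (mul_pos hq hMpos).ne' h0.ne', Real.log_mul hq.ne' hMpos.ne'] at key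
            rw [Real.log_div h0.ne' hq.ne']
            have key2 := mul_le_mul_of_nonneg_left key h0.le
            have : P a * (Q a * M / P a - 1) = Q a * M - P a := by field_simp
            rw [this] at key2
            linarith
        · simp [Set.indicator_of_notMem ha]
    _ = _ + (∑' a, A.indicator (fun a => ENNReal.ofReal (Q a)) a) * ENNReal.ofReal M := by
        rw [ENNReal.tsum_add, ENNReal.tsum_mul_right]
    _ ≤ _ + ENNReal.ofReal (1 / M) * ENNReal.ofReal M := by gcongr
    _ = _ + 1 := by
        rw [← ENNReal.ofReal_mul (by positivity), one_div_mul_cancel hMpos.ne', ENNReal.ofReal_one]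

lemma IsPmf.tsum_ofReal {α : Type*} {P : α → ℝ} (hP : IsPmf P) :
    ∑' a, ENNReal.ofReal (P a) = 1 := by
  rw [← ENNReal.ofReal_tsum_of_nonneg hP.1 hP.2.summable, hP.2.tsum_eq, ENNReal.ofReal_one]

lemma exists_tsum_indicator_le {α T : Type*} [Fintype T] [Nonempty T] {Q : α → ℝ} (hQ : IsPmf Q)
    {A : T → Set α} (hA : Pairwise (Function.onFun Disjoint A)) :
    ∃ t, ∑' a, (A t).indicator (fun a => ENNReal.ofReal (Q a)) a ≤
      ENNReal.ofReal (1 / (Fintype.card T : ℝ)) := by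
  by_contra! hlt
  have hcard : (0 : ℝ) < Fintype.card T := by exact_mod_cast Fintype.card_pos
  have h1 := ENNReal.sum_lt_sum_of_nonempty Finset.univ_nonempty fun t _ => hlt t
  refine absurd h1 (not_lt.2 ?_)
  rw [Finset.sum_const, Finset.card_univ, nsmul_eq_mul, ← ENNReal.ofReal_natCast,
    ← ENNReal.ofReal_mul hcard.le, mul_one_div_cancel hcard.ne', ENNReal.ofReal_one,
    ← hQ.tsum_ofReal, ← Summable.tsum_finsetSum fun _ _ => ENNReal.summable]
  refine ENNReal.tsum_le_tsum fun a => ?_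
  by_cases ha : ∃ t, a ∈ A t
  · obtain ⟨t, ht⟩ := ha
    rw [Finset.sum_eq_single t]
    · exact Set.indicator_le_self' (fun _ _ => zero_le) _
    · intro u _ hu
      exact Set.indicator_of_notMem (fun h => Set.disjoint_left.1 (hA hu) h ht) _
    · simp
  · push Not at ha
    simp [Set.indicator_of_notMem (ha _)]

lemma prodPmf_nonneg {α : Type*} {p : α → ℝ} (hp : ∀ a, 0 ≤ p a) (n : ℕ) (x : Fin n → α) :
    0 ≤ prodPmf p n x :=
  Finset.prod_nonneg fun _ _ => hp _

/-- If finitely many members of a class can be told apart from a sample of size `n` with success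
probability at least `δ`, then the redundancy is at least that of their number. -/
lemma le_minimaxRedundancy {α T : Type*} [Fintype T] [Nonempty T] {Λ : Set (α → ℝ)} {n : ℕ}
    {P : T → α → ℝ} (hP : ∀ t, IsPmf (P t)) (hΛ : ∀ t, P t ∈ Λ) {A : T → Set (Fin n → α)}
    (hA : Pairwise (Function.onFun Disjoint A)) {δ : ℝ}
    (hδ : ∀ t, ENNReal.ofReal δ ≤
      ∑' x, (A t).indicator (fun x => ENNReal.ofReal (prodPmf (P t) n x)) x) :
    ENNReal.ofReal ((δ * Real.log (Fintype.card T) - 1) / Real.log 2) ≤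
      minimaxRedundancy Λ n := by
  refine le_iInf₂ fun Q hQ => ?_
  obtain ⟨t, ht⟩ := exists_tsum_indicator_le hQ hA
  refine le_trans ?_ (le_iSup₂ (P t) (hΛ t))
  exact le_klDiv2_of_indicator (prodPmf_nonneg (hP t).1 n) hQ.1 (A t)
    (by exact_mod_cast Fintype.card_pos) (hδ t) ht

/-- The number of occurrences of a symbol in a word. -/
def count {α : Type*} (k : α) {n : ℕ} (x : Fin n → α) : ℝ :=
  ∑ i, ({k} : Set α).indicator (fun _ => (1 : ℝ)) (x i)

section Measure

variable {α : Type*} [MeasurableSpace α] [MeasurableSingletonClass α]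

lemma IsPmf.exists_measure {p : α → ℝ} (hp : IsPmf p) :
    ∃ μ : Measure α, IsProbabilityMeasure μ ∧ ∀ a, μ {a} = ENNReal.ofReal (p a) := by
  let q : PMF α := ⟨fun a => ENNReal.ofReal (p a), hp.tsum_ofReal ▸ ENNReal.summable.hasSum⟩
  exact ⟨q.toMeasure, inferInstance, fun a =>
    q.toMeasure_apply_singleton a (measurableSet_singleton a)⟩

lemma pi_count_deviation_le {p : α → ℝ} (hp : IsPmf p) {μ : Measure α} [IsProbabilityMeasure μ]
    (hμ : ∀ a, μ {a} = ENNReal.ofReal (p a)) (n : ℕ) (k : α) {r : ℝ} (hr : 0 < r) :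
    Measure.pi (fun _ : Fin n => μ) {x | r ≤ |count k x - n * p k|} ≤
      ENNReal.ofReal (n * p k / r ^ 2) := by
  set f : α → ℝ := ({k} : Set α).indicator (fun _ => (1 : ℝ)) with hf
  have hk : MeasurableSet ({k} : Set α) := measurableSet_singleton k
  have hfm : Measurable f := measurable_const.indicator hk
  have hfL : MemLp f 2 μ := memLp_indicator_const 2 hk 1 (Or.inr (measure_ne_top _ _))
  have hf_mean : ∫ a, f a ∂μ = p k := by
    rw [hf, integral_indicator_const _ hk]
    simp [Measure.real, hμ, hp.1 k]
  have hcount : (count k : (Fin n → α) → ℝ) = ∑ i, fun x => f (x i) := by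
    ext x; simp [count, hf]
  have hmp (i : Fin n) := measurePreserving_eval (fun _ : Fin n => μ) i
  have hL (i : Fin n) : MemLp (fun x : Fin n → α => f (x i)) 2 (Measure.pi fun _ => μ) :=
    hfL.comp_measurePreserving (hmp i)
  have hmean : ∫ x, count k x ∂(Measure.pi fun _ : Fin n => μ) = n * p k := by
    have : ∀ i : Fin n, ∫ x, f (x i) ∂(Measure.pi fun _ : Fin n => μ) = p k := fun i => by
      have h := integral_map (hmp i).measurable.aemeasurable
        (hfm.aestronglyMeasurable (μ := Measure.map (Function.eval i) (Measure.pi fun _ => μ)))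
      rw [(hmp i).map_eq, hf_mean] at h
      exact h.symm
    simp only [hcount, Finset.sum_apply]
    rw [integral_finsetSum _ fun i _ => (hL i).integrable one_le_two]
    simp [this]
  have hvar : variance (count k) (Measure.pi fun _ : Fin n => μ) ≤ n * p k := by
    rw [hcount, variance_sum_pi (X := fun _ => f) fun _ => hfL]
    have : variance f μ ≤ p k := by
      refine (variance_le_expectation_sq hfm.aestronglyMeasurable).trans_eq ?_
      rw [← hf_mean]
      congr 1
      ext a
      by_cases ha : a = k <;> simp [hf, ha]
    simpa using mul_le_mul_of_nonneg_left this (Nat.cast_nonneg n)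
  have hLc : MemLp (count k) 2 (Measure.pi fun _ : Fin n => μ) := by
    rw [hcount]; exact memLp_finsetSum' _ fun i _ => hL i
  have := meas_ge_le_variance_div_sq hLc hr
  rw [hmean] at this
  exact this.trans (ENNReal.ofReal_le_ofReal (by gcongr))

end Measure

lemma le_tsum_indicator_count {α ι : Type*} [Countable α] [Fintype ι] {p : α → ℝ} (hp : IsPmf p) (n : ℕ)
    (k : ι → α) {r : ι → ℝ} (hr : ∀ i, 0 < r i) {ε : ℝ}
    (hε : ∑ i, n * p (k i) / r i ^ 2 ≤ ε) :
    ENNReal.ofReal (1 - ε) ≤ ∑' x : Fin n → α,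
      {x | ∀ i, |count (k i) x - n * p (k i)| < r i}.indicator
        (fun x => ENNReal.ofReal (prodPmf p n x)) x := by
  let _ : MeasurableSpace α := ⊤
  have : MeasurableSingletonClass α := ⟨fun _ => trivial⟩
  obtain ⟨μ, hμp, hμ⟩ := hp.exists_measure
  have hprod (x : Fin n → α) :
      ENNReal.ofReal (prodPmf p n x) = Measure.pi (fun _ : Fin n => μ) {x} := by
    rw [Measure.pi_singleton, prodPmf, ENNReal.ofReal_prod_of_nonneg fun i _ => hp.1 _]
    simp [hμ]
  have hms : ∀ s : Set (Fin n → α), MeasurableSet s := fun s => s.to_countable.measurableSet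
  simp only [hprod]
  rw [Measure.tsum_indicator_apply_singleton _ _ (hms _)]
  set S := {x : Fin n → α | ∀ i, |count (k i) x - n * p (k i)| < r i}
  have h0 : ∀ i, 0 ≤ n * p (k i) / r i ^ 2 := fun i => by have := hp.1 (k i); positivity
  have hc : Measure.pi (fun _ : Fin n => μ) Sᶜ ≤ ENNReal.ofReal ε := by
    have hS : Sᶜ = ⋃ i, {x | r i ≤ |count (k i) x - n * p (k i)|} := by
      ext x; simp [S]
    rw [hS]
    refine (measure_iUnion_fintype_le _ _).trans ?_
    refine le_trans (Finset.sum_le_sum fun i _ => pi_count_deviation_le hp hμ n (k i) (hr i)) ?_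
    rw [← ENNReal.ofReal_sum_of_nonneg fun i _ => h0 i]
    exact ENNReal.ofReal_le_ofReal hε
  have h1 := prob_add_prob_compl (μ := Measure.pi (fun _ : Fin n => μ)) (hms S)
  rw [ENNReal.ofReal_sub _ ((Finset.sum_nonneg fun i _ => h0 i).trans hε), tsub_le_iff_right,
    ENNReal.ofReal_one, ← h1]
  gcongr

/-- The function giving weight `a i` to the symbol `k i`, the remaining mass being put on `1`. -/
def spread {ι : Type*} [Fintype ι] (k : ι → ℕ+) (a : ι → ℝ) : ℕ+ → ℝ :=
  fun x => (Pi.single 1 (1 - ∑ i, a i) : ℕ+ → ℝ) x + ∑ i, (Pi.single (k i) (a i) : ℕ+ → ℝ) x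

section Spread

variable {ι : Type*} [Fintype ι] {k : ι → ℕ+} {a : ι → ℝ}

lemma isPmf_spread (ha : ∀ i, 0 ≤ a i) (hsum : ∑ i, a i ≤ 1) : IsPmf (spread k a) := by
  refine ⟨fun x => add_nonneg ?_ (Finset.sum_nonneg fun i _ => ?_), ?_⟩
  · exact (Pi.single_nonneg.2 (sub_nonneg.2 hsum) : (0 : ℕ+ → ℝ) ≤ _) x
  · exact (Pi.single_nonneg.2 (ha i) : (0 : ℕ+ → ℝ) ≤ _) x
  · have := (hasSum_pi_single (1 : ℕ+) (1 - ∑ i, a i)).add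
      (hasSum_sum (s := Finset.univ) fun i _ => hasSum_pi_single (k i) (a i))
    rwa [sub_add_cancel] at this

lemma spread_apply (hk : Function.Injective k) (hk1 : ∀ i, k i ≠ 1) (i : ι) :
    spread k a (k i) = a i := by
  have h : ∑ j, (Pi.single (k j) (a j) : ℕ+ → ℝ) (k i) = a i := by
    rw [Finset.sum_eq_single i, Pi.single_eq_same]
    · intro j _ hj
      exact Pi.single_eq_of_ne (fun h => hj (hk h).symm) _
    · simp
  rw [spread, h, Pi.single_eq_of_ne (hk1 i), zero_add]

lemma spread_mem_envClass (hk : Function.Injective k) (hk1 : ∀ i, k i ≠ 1) (ha : ∀ i, 0 ≤ a i)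
    (hsum : ∑ i, a i ≤ 1) {f : ℕ+ → ℝ} (hf : ∀ x, 0 ≤ f x) (hf1 : 1 ≤ f 1)
    (haf : ∀ i, a i ≤ f (k i)) : spread k a ∈ envClass f := by
  refine ⟨isPmf_spread ha hsum, fun x => ?_⟩
  by_cases hx : ∃ i, k i = x
  · obtain ⟨i, rfl⟩ := hx
    rw [spread_apply hk hk1]
    exact haf i
  push Not at hx
  have h0 : ∑ i, (Pi.single (k i) (a i) : ℕ+ → ℝ) x = 0 :=
    Finset.sum_eq_zero fun i _ => Pi.single_eq_of_ne (hx i).symm _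
  rw [spread, h0, add_zero]
  by_cases h1 : x = 1
  · subst h1
    have := Finset.sum_nonneg fun i (_ : i ∈ Finset.univ) => ha i
    rw [Pi.single_eq_same]
    linarith
  · rw [Pi.single_eq_of_ne h1]
    exact hf x

lemma le_minimaxRedundancy_envClass [Nonempty ι] (hk : Function.Injective k) (hk1 : ∀ i, k i ≠ 1)
    {b : ι → ℝ} (hb : ∀ i, 0 < b i) (hsum : ∑ i, b i ≤ 1) {f : ℕ+ → ℝ} (hf : ∀ x, 0 ≤ f x)
    (hf1 : 1 ≤ f 1) (hbf : ∀ i, b i ≤ f (k i)) {n : ℕ} (hn : 0 < n) {ε : ℝ} (hε : 0 < ε)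
    (hε1 : ε ≤ 1) :
    ENNReal.ofReal (((1 - ε) *
        ∑ i, Real.log (n * b i / (4 * Fintype.card ι / ε)) / 2 - 1) / Real.log 2) ≤
      minimaxRedundancy (envClass f) n := by
  classical
  have hn' : (0 : ℝ) < n := by exact_mod_cast hn
  have hc : (0 : ℝ) < Fintype.card ι := by exact_mod_cast Fintype.card_pos
  set K : ℝ := 4 * Fintype.card ι / ε with hK
  have hKpos : 0 < K := by positivity
  set s : ι → ℝ := fun i => √(n * b i * K) with hs
  have hspos (i) : 0 < s i := Real.sqrt_pos.2 (by have := hb i; positivity)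
  have hssq (i) : s i ^ 2 = n * b i * K := Real.sq_sqrt (by have := hb i; positivity)
  set m : ι → ℕ := fun i => ⌊n * b i / s i⌋₊ with hm
  let a : (∀ i, Fin (m i + 1)) → ι → ℝ := fun t i => (t i : ℕ) * s i / n
  have ha0 (t i) : 0 ≤ a t i := by have := hspos i; positivity
  have hab (t i) : a t i ≤ b i := by
    have h1 : ((t i : ℕ) : ℝ) ≤ n * b i / s i :=
      le_trans (by exact_mod_cast Nat.lt_succ_iff.1 (t i).2)
        (Nat.floor_le (by have := hb i; have := hspos i; positivity))
    rw [le_div_iff₀ (hspos i)] at h1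
    rw [div_le_iff₀ hn']
    linarith
  have hasum (t) : ∑ i, a t i ≤ 1 := (Finset.sum_le_sum fun i _ => hab t i).trans hsum
  have hna (t i) : n * a t i = (t i : ℕ) * s i := mul_div_cancel₀ _ hn'.ne'
  have hmain := le_minimaxRedundancy (n := n) (P := fun t => spread k (a t))
    (fun t => isPmf_spread (ha0 t) (hasum t))
    (fun t => spread_mem_envClass hk hk1 (ha0 t) (hasum t) hf hf1
      fun i => (hab t i).trans (hbf i))
    (A := fun t => {x | ∀ i, |count (k i) x - n * spread k (a t) (k i)| < s i / 2}) ?_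
    (fun t => le_tsum_indicator_count (isPmf_spread (ha0 t) (hasum t)) n k
      (fun i => half_pos (hspos i)) (ε := ε) ?_)
  · refine le_trans (ENNReal.ofReal_le_ofReal ?_) hmain
    have hlog : ∑ i, Real.log (n * b i / K) / 2 ≤
        Real.log (Fintype.card (∀ i, Fin (m i + 1))) := by
      rw [Fintype.card_pi]
      push_cast
      rw [Real.log_prod fun i _ => by rw [Fintype.card_fin]; positivity]
      refine Finset.sum_le_sum fun i _ => ?_
      have hbi := hb i
      rw [← Real.log_sqrt (by positivity), Fintype.card_fin]
      refine Real.log_le_log (Real.sqrt_pos.2 (by positivity)) ?_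
      refine le_trans (le_of_eq ?_) (Nat.lt_floor_add_one (n * b i / s i)).le |>.trans (by simp [hm])
      rw [Real.sqrt_eq_iff_mul_self_eq (by positivity) (by have := hspos i; positivity), ← sq,
        div_pow, hssq]
      field_simp
    have := Real.log_pos one_lt_two
    have : 0 ≤ 1 - ε := by linarith
    gcongr
  · intro t u htu
    refine Set.disjoint_left.2 fun x hx hy => htu ?_
    funext i
    have h1 := hx i
    have h2 := hy i
    rw [spread_apply hk hk1, hna] at h1 h2
    have h3 : |((t i : ℕ) : ℝ) * s i - (u i : ℕ) * s i| < s i := by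
      rw [abs_lt] at *
      constructor <;> linarith
    rw [← sub_mul, abs_mul, abs_of_pos (hspos i), mul_lt_iff_lt_one_left (hspos i)] at h3
    have h4 : |((t i : ℕ) : ℤ) - ((u i : ℕ) : ℤ)| < 1 := by exact_mod_cast h3
    rw [Int.abs_lt_one_iff] at h4
    exact Fin.ext (by omega)
  · calc ∑ i, n * spread k (a t) (k i) / (s i / 2) ^ 2
        ≤ ∑ _i : ι, ε / Fintype.card ι := by
          refine Finset.sum_le_sum fun i _ => ?_
          rw [spread_apply hk hk1, div_pow, hssq]
          have hbi := hb i
          rw [div_le_div_iff₀ (by positivity) hc, hK]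
          have : n * a t i ≤ n * b i := mul_le_mul_of_nonneg_left (hab t i) hn'.le
          calc _ ≤ n * b i * Fintype.card ι := by gcongr
            _ = _ := by field_simp; norm_num
      _ = ε := by simp; field_simp

end Spread

lemma sum_fin_affine (L : ℕ) (c α : ℝ) :
    ∑ i : Fin L, (c - α * ((i : ℕ) + 2)) / 2 = L * (c - α * (L + 3) / 2) / 2 := by
  rw [Fin.sum_univ_eq_sum_range (fun i => (c - α * ((i : ℕ) + 2)) / 2)]
  induction L with
  | zero => simp
  | succ L ih => rw [Finset.sum_range_succ, ih]; push_cast; ring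

open Filter Topology in
lemma tendsto_redundancy_bound {α : ℝ} (hα : 0 < α) (δ c : ℝ) :
    Tendsto (fun x : ℝ => (δ * (⌊α⁻¹ * x⌋₊ * (x - Real.log ⌊α⁻¹ * x⌋₊ - c -
      α * (⌊α⁻¹ * x⌋₊ + 3) / 2) / 2) - 1) / x ^ 2) atTop (𝓝 (δ / (4 * α))) := by
  have hu := tendsto_nat_floor_mul_div_atTop (R := ℝ) (inv_pos.2 hα).le
  have hL : Tendsto (fun x : ℝ => (⌊α⁻¹ * x⌋₊ : ℝ)) atTop atTop :=
    tendsto_natCast_atTop_atTop.comp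
      (tendsto_nat_floor_atTop.comp (tendsto_id.const_mul_atTop (inv_pos.2 hα)))
  have hv : Tendsto (fun x : ℝ => Real.log ⌊α⁻¹ * x⌋₊ / x) atTop (𝓝 0) := by
    have h := (Real.isLittleO_log_id_atTop.tendsto_div_nhds_zero.comp hL).mul hu
    rw [zero_mul] at h
    refine h.congr fun x => ?_
    rcases eq_or_ne (⌊α⁻¹ * x⌋₊ : ℝ) 0 with h0 | h0
    · simp [h0]
    · rw [Function.comp_apply, id, div_mul_div_cancel₀ h0]
  have hi : Tendsto (fun x : ℝ => x⁻¹) atTop (𝓝 0) := tendsto_inv_atTop_zero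
  have hlim := ((((hu.mul (((tendsto_const_nhds (x := (1 : ℝ))).sub hv |>.sub
    (hi.const_mul c)).sub (((hu.add (hi.const_mul 3)).const_mul α).div_const 2))).div_const
      2).const_mul δ).sub (hi.pow 2))
  have hval : δ * (α⁻¹ * (1 - 0 - c * 0 - α * (α⁻¹ + 3 * 0) / 2) / 2) - 0 ^ 2 = δ / (4 * α) := by
    field_simp
    norm_num
  rw [hval] at hlim
  refine hlim.congr' ?_
  filter_upwards [eventually_gt_atTop 0] with x hx
  field_simp

lemma le_minimaxRedundancy_exp {α C : ℝ} (hα : 0 < α) (hC : Real.exp α ≤ C) {n L : ℕ} (hn : 0 < n)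
    (hL : 0 < L) {ε : ℝ} (hε : 0 < ε) (hε1 : ε ≤ 1) :
    ENNReal.ofReal (((1 - ε) * (L * (Real.log n - Real.log L -
        Real.log (4 / (ε * (1 - Real.exp (-α)))) - α * (L + 3) / 2) / 2) - 1) / Real.log 2) ≤
      minimaxRedundancy (envClass fun k : ℕ+ => min 1 (C * Real.exp (-α * (k : ℝ)))) n := by
  have hn' : (0 : ℝ) < n := by exact_mod_cast hn
  have hL' : (0 : ℝ) < L := by exact_mod_cast hL
  have : Nonempty (Fin L) := ⟨⟨0, hL⟩⟩
  have hr1 : Real.exp (-α) < 1 := by simpa using hα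
  set A := 1 - Real.exp (-α) with hA
  have hA0 : 0 < A := sub_pos.2 hr1
  have hA1 : A ≤ 1 := by have := Real.exp_pos (-α); linarith
  have hC1 : 1 ≤ C := (Real.one_le_exp hα.le).trans hC
  let k : Fin L → ℕ+ := fun i => ⟨i + 2, by omega⟩
  let b : Fin L → ℝ := fun i => A * Real.exp (-α * ((i : ℕ) + 2))
  have hb0 (i) : 0 < b i := mul_pos hA0 (Real.exp_pos _)
  have hb1 (i) : b i ≤ Real.exp (-α) ^ (i : ℕ) * A := by
    rw [← Real.exp_nat_mul, mul_comm]
    refine mul_le_mul_of_nonneg_left (Real.exp_le_exp.2 ?_) hA0.le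
    linarith
  have hsum : ∑ i, b i ≤ 1 := by
    refine (Finset.sum_le_sum fun i _ => hb1 i).trans ?_
    rw [← Finset.sum_mul, Fin.sum_univ_eq_sum_range (fun i => Real.exp (-α) ^ i), hA,
      geom_sum_mul_neg]
    have := pow_pos (Real.exp_pos (-α)) L
    linarith
  have hmain := le_minimaxRedundancy_envClass (k := k) (b := b)
    (f := fun k : ℕ+ => min 1 (C * Real.exp (-α * (k : ℝ))))
    (fun i j hij => Fin.ext (by simpa [k] using congrArg PNat.val hij))
    (fun i h => by simpa [k] using congrArg PNat.val h) hb0 hsum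
    (fun x => le_min zero_le_one (by positivity)) (le_min le_rfl ?_) (fun i => le_min ?_ ?_)
    hn hε hε1
  · refine le_trans (ENNReal.ofReal_le_ofReal (le_of_eq ?_)) hmain
    congr 3
    rw [← sum_fin_affine]
    refine Finset.sum_congr rfl fun i _ => ?_
    congr 1
    have hrw : (n : ℝ) * b i / (4 * Fintype.card (Fin L) / ε) =
        n / L / (4 / (ε * A)) * Real.exp (-α * ((i : ℕ) + 2)) := by
      simp only [b, Fintype.card_fin]
      field_simp
    rw [hrw, Real.log_mul (by positivity) (Real.exp_pos _).ne', Real.log_exp,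
      Real.log_div (x := n / L) (by positivity) (by positivity), Real.log_div hn'.ne' hL'.ne']
    ring
  · calc (1 : ℝ) = Real.exp α * Real.exp (-α) := by rw [← Real.exp_add]; simp
      _ ≤ _ := by simp; gcongr
  · exact (Finset.single_le_sum (fun j _ => (hb0 j).le) (Finset.mem_univ i)).trans hsum
  · simp only [b, k, PNat.mk_coe]
    push_cast
    have := hA1.trans hC1
    gcongr

/-- lower bound `liminf R⁺/(log n)² ≥ 1/(8α)` for exponential envelope
classes. -/
theorem stmt14 (alpha C : ℝ) (halpha : 0 < alpha) (hC : Real.exp (2 * alpha) < C) :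
    ENNReal.ofReal (1 / (8 * alpha)) ≤
      Filter.liminf
        (fun n : ℕ =>
          minimaxRedundancy
              (envClass fun k : ℕ+ => min 1 (C * Real.exp (-alpha * (k : ℝ)))) n /
            ENNReal.ofReal (Real.logb 2 (n : ℝ) ^ 2))
        Filter.atTop := by
  have hδ : 1 / (8 * alpha * Real.log 2) < (1 - 1 / 10) / (4 * alpha) := by
    have := Real.log_two_gt_d9
    rw [div_lt_div_iff₀ (by positivity) (by positivity)]
    nlinarith
  have hlog : Filter.Tendsto (fun n : ℕ => Real.log n) Filter.atTop Filter.atTop :=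
    Real.tendsto_log_atTop.comp tendsto_natCast_atTop_atTop
  have hbound := ((tendsto_redundancy_bound halpha (1 - 1 / 10)
    (Real.log (4 / (1 / 10 * (1 - Real.exp (-alpha)))))).comp hlog).eventually_const_le hδ
  refine Filter.le_liminf_of_le (by isBoundedDefault) ?_
  filter_upwards [hbound, hlog.eventually_ge_atTop alpha, Filter.eventually_gt_atTop 0]
    with n hn hna hn0
  have hlogn : 0 < Real.log n := halpha.trans_le hna
  have hlog2 : 0 < Real.log 2 := Real.log_pos one_lt_two
  have hL : 0 < ⌊alpha⁻¹ * Real.log n⌋₊ := by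
    rw [Nat.floor_pos, ← div_eq_inv_mul, one_le_div halpha]
    exact hna
  have hlogb : 0 < Real.logb 2 n ^ 2 := by rw [Real.logb]; positivity
  have hR := le_minimaxRedundancy_exp halpha
    ((Real.exp_le_exp.2 (by linarith)).trans hC.le) hn0 hL (ε := 1 / 10) (by norm_num) (by norm_num)
  rw [ENNReal.le_div_iff_mul_le (Or.inl (ENNReal.ofReal_pos.2 hlogb).ne') (Or.inl ENNReal.ofReal_ne_top),
    ← ENNReal.ofReal_mul (by positivity)]
  refine le_trans (ENNReal.ofReal_le_ofReal ?_) hR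
  rw [Function.comp_apply, le_div_iff₀ (by positivity)] at hn
  rw [le_div_iff₀ hlog2, Real.logb]
  refine le_trans (le_of_eq ?_) hn
  field_simp
end
end
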